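/- arXiv:1609.01446 — 2 statements merged into one kernel-verified Lean document; each statement's English description precedes it below -/
import Mathlib

section
/- Let P(2r) be the restricted Poisson algebra. Then rk(P(2r)) = p^r. -/
/-!
Preliminary definitions: restricted Lie algebras (following Strade–Farnsteiner),
tori, the invariants `μ` and `rk`.
-/

open scoped TensorProduct

section Defs

variable (p : ℕ) (k : Type*) [Field k] {L : Type*} [LieRing L] [LieAlgebra k L]

/-- Jacobson's formula for a `p`-operation `op` on a Lie algebra `L`:
`(x+y)^{[p]} = x^{[p]} + y^{[p]} + ∑_{i=1}^{p-1} sᵢ(x,y)`, where the `sᵢ(x,y)` are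
determined by `∑ i·sᵢ(x,y)·tⁱ⁻¹ = ad(t•x + y)^{p-1}(x)` in `L ⊗ k[t]`. -/
def JacobsonFormula (op : L → L) : Prop :=
  ∀ x y : L, ∃ s : ℕ → L,
    ((LieAlgebra.ad (Polynomial k) (Polynomial k ⊗[k] L)
        (Polynomial.X ⊗ₜ[k] x + (1 : Polynomial k) ⊗ₜ[k] y)) ^ (p - 1))
        ((1 : Polynomial k) ⊗ₜ[k] x)
      = ∑ i ∈ Finset.range (p - 1), (Polynomial.X ^ i : Polynomial k) ⊗ₜ[k] (((i + 1) • s (i + 1) : L)) ∧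
    op (x + y) = op x + op y + ∑ i ∈ Finset.range (p - 1), s (i + 1)

/-- `op` is a `p`-map (restricted structure) on the Lie algebra `L`. -/
structure IsPMap (op : L → L) : Prop where
  ad_op : ∀ x : L, LieAlgebra.ad k L (op x) = (LieAlgebra.ad k L x) ^ p
  op_smul : ∀ (c : k) (x : L), op (c • x) = c ^ p • op x
  jacobson : JacobsonFormula p k op

variable {p}

/-- An element of a restricted Lie algebra is semisimple if it lies in the span of its
iterated `p`-th powers. -/
def IsSemisimpleElt (op : L → L) (x : L) : Prop :=
  x ∈ Submodule.span k {y : L | ∃ m : ℕ, 1 ≤ m ∧ y = op^[m] x}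

/-- An element is `p`-nilpotent if some iterate of the `p`-map kills it. -/
def IsPNilpotentElt (op : L → L) (x : L) : Prop :=
  ∃ m : ℕ, op^[m] x = 0

/-- A torus of a restricted Lie algebra: a `p`-subalgebra consisting of semisimple
elements. -/
def IsTorus (op : L → L) (t : LieSubalgebra k L) : Prop :=
  (∀ x ∈ t, op x ∈ t) ∧ ∀ x ∈ t, IsSemisimpleElt k op x

/-- `μ(L)`: the maximal dimension of a torus of the restricted Lie algebra `(L, op)`. -/
noncomputable def mu (op : L → L) : ℕ :=
  sSup {d : ℕ | ∃ t : LieSubalgebra k L, IsTorus k op t ∧ Module.finrank k t = d}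

/-- The restriction of the `p`-map to a `p`-subalgebra. -/
def subOp (op : L → L) (K : LieSubalgebra k L) (h : ∀ x ∈ K, op x ∈ K) : K → K :=
  fun x => ⟨op x, h x x.2⟩

end Defs

/-- The rank of a (restricted) Lie algebra: the minimal dimension of a Cartan
subalgebra. By Premet's theorem this agrees with `dim C_L(t)` for any torus of maximal
dimension. -/
noncomputable def lieRank (k L : Type*) [Field k] [LieRing L] [LieAlgebra k L] : ℕ :=
  sInf {d : ℕ | ∃ H : LieSubalgebra k L, H.IsCartanSubalgebra ∧ Module.finrank k H = d}

/-- The canonical projection onto the quotient by a Lie ideal, as a morphism of Lie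
algebras. -/
def quotMk {k L : Type*} [Field k] [LieRing L] [LieAlgebra k L] (I : LieIdeal k L) :
    L →ₗ⁅k⁆ L ⧸ I :=
  { I.toSubmodule.mkQ with map_lie' := rfl }

/-!
The truncated polynomial ring `A(n) = k[X₁,…,Xₙ]/(X₁^p,…,Xₙ^p)`, its partial derivatives,
the Jacobson–Witt algebra `W(n) = Der(A(n))`, and related Lie algebras of Cartan type.
-/

set_option synthInstance.maxHeartbeats 1000000
set_option maxHeartbeats 1600000

section Trunc

variable (p : ℕ) (k : Type*) [Field k] (n : ℕ)

/-- The defining ideal `(X₁^p, …, Xₙ^p)`. -/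
noncomputable abbrev truncIdeal : Ideal (MvPolynomial (Fin n) k) :=
  Ideal.span {f | ∃ i : Fin n, f = MvPolynomial.X i ^ p}

/-- The truncated polynomial ring `A(n) := k[X₁,…,Xₙ]/(X₁^p,…,Xₙ^p)`. -/
noncomputable abbrev TruncPoly := MvPolynomial (Fin n) k ⧸ truncIdeal p k n

variable [CharP k p]

theorem pderiv_mem_truncIdeal (i : Fin n) {f : MvPolynomial (Fin n) k}
    (hf : f ∈ truncIdeal p k n) : MvPolynomial.pderiv i f ∈ truncIdeal p k n := by
  induction hf using Submodule.span_induction with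
  | mem x hx =>
    obtain ⟨j, rfl⟩ := hx
    have h0 : (p : MvPolynomial (Fin n) k) = 0 := CharP.cast_eq_zero _ p
    rw [Derivation.leibniz_pow]
    rw [nsmul_eq_mul, h0, zero_mul]
    exact Ideal.zero_mem _
  | zero => simp only [map_zero]; exact Ideal.zero_mem _
  | add x y _ _ hx hy => rw [map_add]; exact Ideal.add_mem _ hx hy
  | smul a x hxmem hx =>
    rw [smul_eq_mul, Derivation.leibniz, smul_eq_mul, smul_eq_mul]
    exact Ideal.add_mem _ (Ideal.mul_mem_left _ _ hx) (Ideal.mul_mem_right _ _ hxmem)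

/-- The partial derivative `∂/∂Xᵢ` on the truncated polynomial ring, as a derivation. -/
noncomputable def truncPD (i : Fin n) :
    Derivation k (TruncPoly p k n) (TruncPoly p k n) where
  toFun := fun a => Quotient.liftOn' a
    (fun f => Ideal.Quotient.mk (truncIdeal p k n) (MvPolynomial.pderiv i f))
    (by
      intro f g hfg
      rw [Submodule.quotientRel_def] at hfg
      rw [Ideal.Quotient.eq]
      rw [← map_sub]
      exact pderiv_mem_truncIdeal p k n i hfg)
  map_add' := by
    rintro ⟨f⟩ ⟨g⟩
    show Ideal.Quotient.mk _ (MvPolynomial.pderiv i (f + g)) =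
      Ideal.Quotient.mk _ (MvPolynomial.pderiv i f) +
        Ideal.Quotient.mk _ (MvPolynomial.pderiv i g)
    rw [map_add, map_add]
  map_smul' := by
    rintro c ⟨f⟩
    show Ideal.Quotient.mkₐ k (truncIdeal p k n) (MvPolynomial.pderiv i (c • f)) =
      c • Ideal.Quotient.mkₐ k (truncIdeal p k n) (MvPolynomial.pderiv i f)
    rw [Derivation.map_smul, map_smul]
  map_one_eq_zero' := by
    show Ideal.Quotient.mk (truncIdeal p k n) (MvPolynomial.pderiv i 1) = 0
    simp only [Derivation.map_one_eq_zero, map_zero]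
  leibniz' := by
    rintro ⟨f⟩ ⟨g⟩
    show Ideal.Quotient.mk (truncIdeal p k n) (MvPolynomial.pderiv i (f * g)) =
      (Ideal.Quotient.mk (truncIdeal p k n) f) *
          (Ideal.Quotient.mk (truncIdeal p k n) (MvPolynomial.pderiv i g)) +
        (Ideal.Quotient.mk (truncIdeal p k n) g) *
          (Ideal.Quotient.mk (truncIdeal p k n) (MvPolynomial.pderiv i f))
    rw [Derivation.leibniz, smul_eq_mul, smul_eq_mul, map_add, map_mul, map_mul]

/-- The image of the variable `Xᵢ` in the truncated polynomial ring. -/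
noncomputable def truncX (i : Fin n) : TruncPoly p k n :=
  Ideal.Quotient.mk (truncIdeal p k n) (MvPolynomial.X i)

end Trunc

section Poisson

variable (p : ℕ) (k : Type*) [Field k] [CharP k p]

/-- The Poisson bracket on the truncated polynomial ring `A(2r)`:
`{f, g} = ∑ᵢ (∂ᵢ(f) ∂_{i+r}(g) − ∂_{i+r}(f) ∂ᵢ(g))`. -/
noncomputable def poissonBracket (r : ℕ) (f g : TruncPoly p k (2 * r)) :
    TruncPoly p k (2 * r) :=
  ∑ i : Fin r,
    (truncPD p k (2 * r) ⟨i.1, by have := i.isLt; omega⟩ f *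
        truncPD p k (2 * r) ⟨i.1 + r, by have := i.isLt; omega⟩ g
      - truncPD p k (2 * r) ⟨i.1 + r, by have := i.isLt; omega⟩ f *
        truncPD p k (2 * r) ⟨i.1, by have := i.isLt; omega⟩ g)

end Poisson

section PFun
open Polynomial

/-- polynomial families of endomorphisms -/
def PFam {k A ι : Type*} [Field k] [AddCommGroup A] [Module k A] [Fintype ι] [DecidableEq ι]
    (b : Module.Basis ι k A) (F : k → Module.End k A) : Prop :=
  ∃ M : Matrix ι ι k[X], ∀ s, LinearMap.toMatrix b b (F s) = M.map (evalRingHom s)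

variable {k A ι : Type*} [Field k] [AddCommGroup A] [Module k A] [Fintype ι] [DecidableEq ι]
  {b : Module.Basis ι k A}

lemma PFam.const (T : Module.End k A) : PFam b (fun _ => T) :=
  ⟨(LinearMap.toMatrix b b T).map C, fun s => by ext i j; simp⟩

lemma PFam.add {F G : k → Module.End k A} (hF : PFam b F) (hG : PFam b G) :
    PFam b (fun s => F s + G s) := by
  obtain ⟨M, hM⟩ := hF
  obtain ⟨N, hN⟩ := hG
  exact ⟨M + N, fun s => by rw [map_add, hM, hN]; ext i j; simp⟩

lemma PFam.mul {F G : k → Module.End k A} (hF : PFam b F) (hG : PFam b G) :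
    PFam b (fun s => F s * G s) := by
  obtain ⟨M, hM⟩ := hF
  obtain ⟨N, hN⟩ := hG
  exact ⟨M * N, fun s => by rw [LinearMap.toMatrix_mul, hM, hN, Matrix.map_mul]⟩

lemma PFam.smulX {F : k → Module.End k A} (hF : PFam b F) :
    PFam b (fun s => s • F s) := by
  obtain ⟨M, hM⟩ := hF
  exact ⟨(X : k[X]) • M, fun s => by rw [map_smul, hM]; ext i j; simp⟩

lemma PFam.smul {F : k → Module.End k A} (c : k) (hF : PFam b F) :
    PFam b (fun s => c • F s) := by
  obtain ⟨M, hM⟩ := hF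
  exact ⟨(C c : k[X]) • M, fun s => by rw [map_smul, hM]; ext i j; simp⟩

lemma PFam.sub {F G : k → Module.End k A} (hF : PFam b F) (hG : PFam b G) :
    PFam b (fun s => F s - G s) := by
  obtain ⟨M, hM⟩ := hF
  obtain ⟨N, hN⟩ := hG
  exact ⟨M - N, fun s => by rw [map_sub, hM, hN]; ext i j; simp⟩

lemma PFam.pow {F : k → Module.End k A} (hF : PFam b F) (n : ℕ) :
    PFam b (fun s => F s ^ n) := by
  induction n with
  | zero => simpa using PFam.const 1
  | succ n ih => simpa only [pow_succ] using ih.mul hF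

lemma PFam.eval {F : k → Module.End k A} (hF : PFam b F) (l : A →ₗ[k] k) (v : A) :
    ∃ q : k[X], ∀ s, l (F s v) = q.eval s := by
  obtain ⟨M, hM⟩ := hF
  refine ⟨∑ i, (∑ j, M i j * C (b.repr v j)) * C (l (b i)), fun s => ?_⟩
  have h := LinearMap.toMatrix_mulVec_repr b b (F s) v
  conv_lhs => rw [← b.sum_repr (F s v)]
  rw [← h, hM]
  simp [eval_finsetSum, Matrix.mulVec, dotProduct]

lemma PFam.key [Infinite k] {D L : k → Module.End k A} (hD : PFam b D) (hL : PFam b L)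
    (v : A) (N : ℕ) (hind : LinearIndependent k (fun j : Fin N => (L 1 ^ (j : ℕ)) v))
    (hker : ∀ s, s ≠ 0 → ∀ j : ℕ, D s ((L s ^ j) v) = 0) :
    N ≤ Module.finrank k ((D 0).maxGenEigenspace 0) := by
  have : Module.Finite k A := Module.Finite.of_basis b
  -- dual functionals
  obtain ⟨l, hl⟩ : ∃ l : Fin N → (A →ₗ[k] k), ∀ i j : Fin N,
      l i ((L 1 ^ (j : ℕ)) v) = if i = j then 1 else 0 := by
    obtain ⟨g, hg⟩ := (Finsupp.linearCombination k
      (fun j : Fin N => (L 1 ^ (j : ℕ)) v)).exists_leftInverse_of_injective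
      (LinearMap.ker_eq_bot.mpr hind)
    refine ⟨fun i => (Finsupp.lapply i).comp g, fun i j => ?_⟩
    have := LinearMap.congr_fun hg (Finsupp.single j 1)
    simp only [LinearMap.comp_apply, Finsupp.linearCombination_single, one_smul,
      LinearMap.id_apply] at this
    simp [this, Finsupp.single_apply, eq_comm]
  choose q hq using fun i j : Fin N => (hL.pow (j : ℕ)).eval (l i) v
  obtain ⟨M, hM⟩ := hD
  let w : k[X] := (Matrix.of q).det
  have hw : ∀ s, w.eval s = (Matrix.of fun i j : Fin N => l i ((L s ^ (j : ℕ)) v)).det := by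
    intro s
    have := (evalRingHom s).map_det (Matrix.of q)
    simp only [coe_evalRingHom] at this
    rw [this]
    congr 1
    ext i j
    simp [hq]
  have hw1 : w ≠ 0 := by
    intro h0
    have := hw 1
    rw [h0] at this
    have h1 : (Matrix.of fun i j : Fin N => l i ((L 1 ^ (j : ℕ)) v)) = 1 := by
      ext i j
      simp [hl, Matrix.one_apply]
    rw [h1] at this
    simp at this
  have hchar : ∀ s, (D s).charpoly = M.charpoly.map (evalRingHom s) := by
    intro s
    rw [← LinearMap.charpoly_toMatrix (D s) b, hM, Matrix.charpoly_map]
  have hbig : ∀ s, s ≠ 0 → w.eval s ≠ 0 →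
      N ≤ Module.finrank k ((D s).maxGenEigenspace 0) := by
    intro s hs hws
    have hli : LinearIndependent k (fun j : Fin N => (L s ^ (j : ℕ)) v) := by
      rw [hw] at hws
      rw [Fintype.linearIndependent_iff]
      intro g hg
      have : (Matrix.of fun i j : Fin N => l i ((L s ^ (j : ℕ)) v)).mulVec g = 0 := by
        ext i
        have := congrArg (l i) hg
        simpa [Matrix.mulVec, dotProduct, mul_comm] using this
      have := Matrix.eq_zero_of_mulVec_eq_zero hws this
      exact fun i => congrFun this i
    have h1 := finrank_span_eq_card hli
    rw [Fintype.card_fin] at h1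
    rw [← h1]
    apply Submodule.finrank_mono
    rw [Submodule.span_le]
    rintro _ ⟨j, rfl⟩
    rw [SetLike.mem_coe, Module.End.mem_maxGenEigenspace]
    exact ⟨1, by simpa using hker s hs j⟩
  rw [LinearMap.finrank_maxGenEigenspace_zero_eq]
  have hcoef : ∀ m < N, M.charpoly.coeff m = 0 := by
    intro m hm
    have : X * w * M.charpoly.coeff m = 0 := by
      apply Polynomial.funext
      intro s
      simp only [eval_mul, eval_X, eval_zero]
      by_cases hs : s = 0
      · simp [hs]
      by_cases hws : w.eval s = 0
      · simp [hws]
      have h2 := hbig s hs hws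
      rw [LinearMap.finrank_maxGenEigenspace_zero_eq] at h2
      have h3 := coeff_eq_zero_of_lt_natTrailingDegree (lt_of_lt_of_le hm h2)
      rw [hchar, coeff_map] at h3
      simp only [coe_evalRingHom] at h3
      rw [h3, mul_zero]
    rcases mul_eq_zero.mp this with h | h
    · exact absurd h (mul_ne_zero X_ne_zero hw1)
    · exact h
  apply le_natTrailingDegree
  · exact (LinearMap.charpoly_monic _).ne_zero
  · intro m hm
    rw [hchar, coeff_map, hcoef m hm, map_zero]

end PFun

section WS

/-- Canonical coordinates. -/
structure WS {k A : Type*} [Field k] [CommRing A] [Algebra k A] {r : ℕ} (x y : Fin r → A)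
    (dx dy : Fin r → Derivation k A A) : Prop where
  xx : ∀ i j, dx i (x j) = if i = j then 1 else 0
  xy : ∀ i j, dx i (y j) = 0
  yx : ∀ i j, dy i (x j) = 0
  yy : ∀ i j, dy i (y j) = if i = j then 1 else 0
  gen : Algebra.adjoin k (Set.range x ∪ Set.range y) = ⊤

variable {k A : Type*} [Field k] [CommRing A] [Algebra k A] {r : ℕ} {x y : Fin r → A}
    {dx dy : Fin r → Derivation k A A}

lemma WS.swap (h : WS x y dx dy) : WS y x dy dx :=
  ⟨h.yy, h.yx, h.xy, h.xx, by rw [Set.union_comm]; exact h.gen⟩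

lemma WS.ind (h : WS x y dx dy) {C : A → Prop} (hc : ∀ c : k, C (algebraMap k A c))
    (ha : ∀ f g, C f → C g → C (f + g)) (hx : ∀ i f, C f → C (x i * f))
    (hy : ∀ i f, C f → C (y i * f)) (f : A) : C f := by
  have hmem : f ∈ Algebra.adjoin k (Set.range x ∪ Set.range y) := by rw [h.gen]; trivial
  suffices H : ∀ g, C g → C (f * g) by simpa using H 1 (by simpa using hc 1)
  induction hmem using Algebra.adjoin_induction with
  | mem z hz =>
    rcases hz with ⟨i, rfl⟩ | ⟨i, rfl⟩
    · exact hx i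
    · exact hy i
  | algebraMap c =>
    intro g hg
    have hmem : g ∈ Algebra.adjoin k (Set.range x ∪ Set.range y) := by rw [h.gen]; trivial
    -- scalar multiples
    clear hg
    suffices H : ∀ g', C g' → C (algebraMap k A c * g * g') → True by
      have key : ∀ (g : A), g ∈ Algebra.adjoin k (Set.range x ∪ Set.range y) →
          ∀ g', (∀ c : k, C (algebraMap k A c * g')) → ∀ c : k, C (algebraMap k A c * (g * g')) := by
        intro g hg
        induction hg using Algebra.adjoin_induction with
        | mem z hz =>
          intro g' hg' c
          rcases hz with ⟨i, rfl⟩ | ⟨i, rfl⟩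
          · rw [mul_left_comm]; exact hx i _ (hg' c)
          · rw [mul_left_comm]; exact hy i _ (hg' c)
        | algebraMap d =>
          intro g' hg' c
          rw [← mul_assoc, ← map_mul]; exact hg' _
        | add a b _ _ iha ihb =>
          intro g' hg' c
          rw [add_mul, mul_add]
          exact ha _ _ (iha g' hg' c) (ihb g' hg' c)
        | mul a b _ _ iha ihb =>
          intro g' hg' c
          rw [mul_assoc]
          exact iha _ (ihb g' hg') c
      have := key g hmem 1 (fun c => by simpa using hc c) c
      simpa using this
    intros; trivial
  | add a b _ _ iha ihb =>
    intro g hg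
    rw [add_mul]
    exact ha _ _ (iha g hg) (ihb g hg)
  | mul a b _ _ iha ihb =>
    intro g hg
    rw [mul_assoc]
    exact iha _ (ihb g hg)

lemma WS.comm_xx (h : WS x y dx dy) (i j : Fin r) (f : A) : dx i (dx j f) = dx j (dx i f) := by
  induction f using h.ind with
  | hc c => simp
  | ha f g hf hg => simp [hf, hg]
  | hx l f hf => simp [h.xx, hf]; split_ifs <;> simp [add_comm, add_left_comm]
  | hy l f hf => simp [h.xy, hf]

lemma WS.comm_xy (h : WS x y dx dy) (i j : Fin r) (f : A) : dx i (dy j f) = dy j (dx i f) := by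
  induction f using h.ind with
  | hc c => simp
  | ha f g hf hg => simp [hf, hg]
  | hx l f hf => simp [h.xx, h.yx, hf]; split_ifs <;> simp
  | hy l f hf => simp [h.xy, h.yy, hf]; split_ifs <;> simp

/-- the left generators -/
def genL (x y : Fin r → A) (dx : Fin r → Derivation k A A) (s : k) : Set (Module.End k A) :=
  Set.range (fun i => LinearMap.mulLeft k (x i)) ∪
    Set.range (fun i => LinearMap.mulLeft k (y i) + s • (dx i : A →ₗ[k] A))

lemma WS.commute_gen (h : WS x y dx dy) (s : k) {S T : Module.End k A}
    (hS : S ∈ Algebra.adjoin k (genL x y dx s)) (hT : T ∈ Algebra.adjoin k (genL y x dy s)) :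
    Commute S T := by
  refine Algebra.commute_of_mem_adjoin_of_forall_mem_commute hT fun T hT => ?_
  refine (Algebra.commute_of_mem_adjoin_of_forall_mem_commute hS fun S hS => ?_).symm
  refine Commute.symm ?_
  rcases hS with ⟨i, rfl⟩ | ⟨i, rfl⟩ <;> rcases hT with ⟨j, rfl⟩ | ⟨j, rfl⟩
  · ext g; simp; ring
  · ext g
    simp [h.yx, mul_add]; ring
  · ext g
    simp [h.xy, mul_add]; ring
  · ext g
    simp [h.xx, h.yy, h.comm_xy, mul_add, smul_add]
    by_cases hij : i = j
    · subst hij; simp; ring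
    · simp [hij, Ne.symm hij]; ring

/-- quantization of `f` -/
structure Good {ι : Type*} [Fintype ι] [DecidableEq ι] (b : Module.Basis ι k A)
    (x y : Fin r → A) (dx dy : Fin r → Derivation k A A) (f : A) (L : k → Module.End k A) :
    Prop where
  mem : ∀ s, L s ∈ Algebra.adjoin k (genL x y dx s)
  one : ∀ s, L s 1 = f
  exp : ∃ E, PFam b E ∧ ∀ s, L s = LinearMap.mulLeft k f +
    s • (∑ i, LinearMap.mulLeft k (dy i f) * (dx i : A →ₗ[k] A) : Module.End k A) + (s * s) • E s

variable {ι : Type*} [Fintype ι] [DecidableEq ι] {b : Module.Basis ι k A}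

lemma Good.const (c : k) : Good b x y dx dy (algebraMap k A c) (fun _ => algebraMap k _ c) where
  mem s := Subalgebra.algebraMap_mem _ _
  one s := by simp [Algebra.algebraMap_eq_smul_one]
  exp := ⟨fun _ => 0, PFam.const 0, fun s => by
    ext g; simp [Module.algebraMap_end_apply, Algebra.smul_def]⟩

lemma Good.add {f g : A} {L M : k → Module.End k A} (hf : Good b x y dx dy f L)
    (hg : Good b x y dx dy g M) : Good b x y dx dy (f + g) (fun s => L s + M s) where
  mem s := add_mem (hf.mem s) (hg.mem s)
  one s := by simp [hf.one, hg.one]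
  exp := by
    obtain ⟨E, hE, hE'⟩ := hf.exp
    obtain ⟨F, hF, hF'⟩ := hg.exp
    refine ⟨_, hE.add hF, fun s => ?_⟩
    rw [hE', hF']
    ext g
    simp [Finset.sum_add_distrib, add_mul]
    abel

lemma Good.smul (c : k) {f : A} {L : k → Module.End k A} (hf : Good b x y dx dy f L) :
    Good b x y dx dy (c • f) (fun s => c • L s) where
  mem s := Subalgebra.smul_mem _ (hf.mem s) c
  one s := by simp [hf.one]
  exp := by
    obtain ⟨E, hE, hE'⟩ := hf.exp
    refine ⟨_, hE.smul c, fun s => ?_⟩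
    rw [hE']
    ext g
    simp [← Finset.smul_sum]
    simp only [smul_comm c]

lemma Good.mulx (h : WS x y dx dy) (i : Fin r) {f : A} {L : k → Module.End k A}
    (hf : Good b x y dx dy f L) :
    Good b x y dx dy (x i * f) (fun s => LinearMap.mulLeft k (x i) * L s) where
  mem s := mul_mem (Algebra.subset_adjoin (Or.inl ⟨i, rfl⟩)) (hf.mem s)
  one s := by simp [hf.one]
  exp := by
    obtain ⟨E, hE, hE'⟩ := hf.exp
    refine ⟨_, (PFam.const (LinearMap.mulLeft k (x i))).mul hE, fun s => ?_⟩
    rw [hE']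
    ext g
    simp [h.yx, mul_add, Finset.mul_sum]

lemma Good.muly (h : WS x y dx dy) (i : Fin r) {f : A} {L : k → Module.End k A}
    (hf : Good b x y dx dy f L) :
    Good b x y dx dy (y i * f)
      (fun s => L s * (LinearMap.mulLeft k (y i) + s • (dx i : A →ₗ[k] A))) where
  mem s := mul_mem (hf.mem s) (Algebra.subset_adjoin (Or.inr ⟨i, rfl⟩))
  one s := by
    have h1 := h.commute_gen s (hf.mem s)
      (T := LinearMap.mulLeft k (y i)) (Algebra.subset_adjoin (Or.inl ⟨i, rfl⟩))
    have h2 := LinearMap.congr_fun h1.eq 1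
    simp [hf.one] at h2
    simp [h2]
  exp := by
    obtain ⟨E, hE, hE'⟩ := hf.exp
    refine ⟨fun s => E s * (LinearMap.mulLeft k (y i) + s • (dx i : A →ₗ[k] A)) +
      (∑ j, LinearMap.mulLeft k (dy j f) * (dx j : A →ₗ[k] A) : Module.End k A) *
        (dx i : A →ₗ[k] A), ?_, fun s => ?_⟩
    · exact (hE.mul ((PFam.const _).add (PFam.const _).smulX)).add
        ((PFam.const _).mul (PFam.const _))
    rw [hE']
    have e1 : (∑ j, LinearMap.mulLeft k (dy j (y i * f)) * (dx j : A →ₗ[k] A) : Module.End k A)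
        = LinearMap.mulLeft k f * (dx i : A →ₗ[k] A) +
        (∑ j, LinearMap.mulLeft k (dy j f) * (dx j : A →ₗ[k] A) : Module.End k A) *
          LinearMap.mulLeft k (y i) := by
      ext g
      simp [h.xy, h.yy, add_mul, Finset.sum_add_distrib, ite_mul, mul_ite]
      rw [add_comm]
      congr 1
      exact Finset.sum_congr rfl fun j _ => by ring
    rw [e1]
    have e2 : LinearMap.mulLeft k (y i * f) = LinearMap.mulLeft k f * LinearMap.mulLeft k (y i) := by
      ext g; simp; ring
    rw [e2]
    generalize (∑ j, LinearMap.mulLeft k (dy j f) * (dx j : A →ₗ[k] A) : Module.End k A) = S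
    simp only [add_mul, mul_add, smul_mul_assoc, mul_smul_comm, smul_add, smul_smul]
    module

lemma WS.exists_good (h : WS x y dx dy) (b : Module.Basis ι k A) (f : A) :
    ∃ L, Good b x y dx dy f L := by
  induction f using h.ind with
  | hc c => exact ⟨_, Good.const c⟩
  | ha f g hf hg =>
    obtain ⟨L, hL⟩ := hf
    obtain ⟨M, hM⟩ := hg
    exact ⟨_, hL.add hM⟩
  | hx i f hf =>
    obtain ⟨L, hL⟩ := hf
    exact ⟨_, hL.mulx h i⟩
  | hy i f hf =>
    obtain ⟨L, hL⟩ := hf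
    exact ⟨_, hL.muly h i⟩

lemma Good.pfam {f : A} {L : k → Module.End k A} (hf : Good b x y dx dy f L) : PFam b L := by
  obtain ⟨E, hE, hE'⟩ := hf.exp
  have : L = fun s => _ := funext hE'
  rw [this]
  refine ((PFam.const _).add (PFam.const _).smulX).add ?_
  simpa only [mul_smul] using hE.smulX.smulX

end WS

section Lower

variable {k A : Type*} [Field k] [CommRing A] [Algebra k A] {r : ℕ} {x y : Fin r → A}
    {dx dy : Fin r → Derivation k A A}

lemma der_prod_zero (d : Derivation k A A) (g : Fin r → A) (n : Fin r → ℕ)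
    (hd : ∀ j, d (g j) = 0) (S : Finset (Fin r)) : d (∏ j ∈ S, g j ^ n j) = 0 := by
  induction S using Finset.induction_on with
  | empty => simp
  | insert a S ha ih => rw [Finset.prod_insert ha]; simp [ih, hd, Derivation.leibniz_pow]

lemma der_euler (d : Fin r → Derivation k A A) (g : Fin r → A) (n : Fin r → ℕ)
    (hd : ∀ i j, d i (g j) = if i = j then 1 else 0) (i : Fin r) (S : Finset (Fin r)) :
    g i * d i (∏ j ∈ S, g j ^ n j) = (if i ∈ S then (n i : A) else 0) * ∏ j ∈ S, g j ^ n j := by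
  induction S using Finset.induction_on with
  | empty => simp
  | insert a S ha ih =>
    rw [Finset.prod_insert ha, Derivation.leibniz, mul_add, smul_eq_mul, smul_eq_mul,
      mul_left_comm, ih, Derivation.leibniz_pow, hd]
    by_cases h : i = a
    · subst h
      simp only [ha, if_false, zero_mul, mul_zero, zero_add, if_true, Finset.mem_insert_self,
        smul_eq_mul, mul_one, nsmul_eq_mul]
      rcases Nat.eq_zero_or_pos (n i) with h0 | h0
      · simp [h0]
      · obtain ⟨m, hm⟩ := Nat.exists_eq_succ_of_ne_zero h0.ne'
        rw [hm]
        simp only [Nat.succ_eq_add_one, Nat.add_sub_cancel, pow_succ]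
        ring
    · simp [h]
      ring

lemma exists_coeffs (k : Type*) [Field k] [Infinite k] (p : ℕ) [CharP k p] (r : ℕ) :
    ∃ c : Fin r → k, Function.Injective (fun a : Fin r → Fin p => ∑ i, c i * ((a i : ℕ) : k)) := by
  classical
  let q : (Fin r → Fin p) × (Fin r → Fin p) → Polynomial k := fun ab =>
    ∑ i : Fin r, Polynomial.C (((ab.1 i : ℕ) : k) - ((ab.2 i : ℕ) : k)) * Polynomial.X ^ (i : ℕ)
  have hq : ∀ ab, ab.1 ≠ ab.2 → q ab ≠ 0 := by
    intro ab hab h0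
    apply hab
    funext i
    have h1 := congrArg (fun f => Polynomial.coeff f (i : ℕ)) h0
    simp only [q, Polynomial.finsetSum_coeff, Polynomial.coeff_C_mul, Polynomial.coeff_X_pow,
      Polynomial.coeff_zero, mul_ite, mul_one, mul_zero] at h1
    rw [Finset.sum_eq_single i] at h1
    · simp only [if_true] at h1
      rw [sub_eq_zero, CharP.natCast_eq_natCast k p] at h1
      have := Nat.ModEq.eq_of_lt_of_lt h1 (ab.1 i).2 (ab.2 i).2
      exact Fin.ext this
    · intro j _ hj
      rw [if_neg]
      intro h
      exact hj (Fin.ext h.symm)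
    · simp
  have hprod : (∏ ab ∈ Finset.univ.filter (fun ab => ab.1 ≠ ab.2), q ab) ≠ 0 := by
    rw [Finset.prod_ne_zero_iff]
    intro ab hab
    exact hq ab (by simpa using hab)
  obtain ⟨z, hz⟩ : ∃ z, Polynomial.eval z
      (∏ ab ∈ Finset.univ.filter (fun ab => ab.1 ≠ ab.2), q ab) ≠ 0 := by
    by_contra! hcon
    exact hprod (Polynomial.funext (by simpa using hcon))
  refine ⟨fun i => z ^ (i : ℕ), fun a b hab => ?_⟩
  by_contra hne
  rw [Polynomial.eval_prod, Finset.prod_ne_zero_iff] at hz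
  apply hz (a, b) (by simpa using hne)
  simp only [q, Polynomial.eval_finsetSum, Polynomial.eval_mul, Polynomial.eval_C,
    Polynomial.eval_pow, Polynomial.eval_X, sub_mul, Finset.sum_sub_distrib]
  rw [sub_eq_zero]
  simpa only [mul_comm] using hab

variable {ι : Type*} [Fintype ι] [DecidableEq ι] {b : Module.Basis ι k A}

lemma Good.sum {f : Fin r → A} {L : Fin r → k → Module.End k A}
    (hf : ∀ i, Good b x y dx dy (f i) (L i)) (S : Finset (Fin r)) :
    Good b x y dx dy (∑ i ∈ S, f i) (fun s => ∑ i ∈ S, L i s) := by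
  induction S using Finset.induction_on with
  | empty => simpa using Good.const (b := b) (x := x) (y := y) (dx := dx) (dy := dy) (0 : k)
  | insert a S ha ih =>
    simp only [Finset.sum_insert ha]
    exact (hf a).add ih

lemma WS.exists_regular (h : WS x y dx dy) [Infinite k] (p : ℕ) (hp : p.Prime) [CharP k p]
    (hyp : ∀ i, y i ^ p = 0) (htop : (∏ i, x i ^ (p - 1)) * ∏ i, y i ^ (p - 1) ≠ 0)
    (b : Module.Basis ι k A) :
    ∃ f L, Good b x y dx dy f L ∧
      LinearIndependent k (fun j : Fin (p ^ r) => (L 1 ^ (j : ℕ)) (1 : A)) := by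
  classical
  obtain ⟨c, hc⟩ := exists_coeffs k p r
  have hgood := Good.sum (fun i => Good.smul (c i)
    (Good.mulx h i (Good.muly h i (Good.const (b := b) 1)))) Finset.univ
  refine ⟨_, _, hgood, ?_⟩
  have hmem := hgood.mem 1
  beta_reduce at hmem ⊢
  generalize hT : (∑ i, c i • (LinearMap.mulLeft k (x i) * (algebraMap k (Module.End k A) 1 *
      (LinearMap.mulLeft k (y i) + (1 : k) • (dx i : A →ₗ[k] A))))) = T at hmem ⊢
  let v : (Fin r → Fin p) → A := fun a => (∏ i, x i ^ (a i : ℕ)) * ∏ i, y i ^ (p - 1)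
  have hY : ∀ i, y i * ∏ i, y i ^ (p - 1) = 0 := by
    intro i
    obtain ⟨w, hw⟩ := Finset.dvd_prod_of_mem (fun i => y i ^ (p - 1)) (Finset.mem_univ i)
    rw [hw, ← mul_assoc, ← pow_succ', Nat.sub_add_cancel hp.one_le, hyp, zero_mul]
  have hv : ∀ a, T (v a) = (∑ i, c i * ((a i : ℕ) : k)) • v a := by
    intro a
    rw [← hT, Finset.sum_smul]
    simp only [LinearMap.sum_apply]
    refine Finset.sum_congr rfl fun i _ => ?_
    have e1 := der_euler dx x (fun i => (a i : ℕ)) h.xx i Finset.univ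
    have e2 := der_prod_zero (dx i) y (fun _ => p - 1) (h.xy i) Finset.univ
    have e3 : y i * v a = 0 := by
      simp only [v]; rw [mul_left_comm, hY, mul_zero]
    have e4 : x i * dx i (v a) = ((a i : ℕ) : A) * v a := by
      simp only [v]
      rw [Derivation.leibniz, e2, smul_zero, zero_add, smul_eq_mul, mul_left_comm, e1]
      simp only [Finset.mem_univ, if_true]
      ring
    simp [e3, e4, mul_smul]
    rw [← nsmul_eq_mul, Nat.cast_smul_eq_nsmul]
  have hv0 : ∀ a, v a ≠ 0 := by
    intro a h0
    apply htop
    have : (∏ i, x i ^ (p - 1)) = (∏ i, x i ^ (p - 1 - (a i : ℕ))) * ∏ i, x i ^ (a i : ℕ) := by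
      rw [← Finset.prod_mul_distrib]
      refine Finset.prod_congr rfl fun i _ => ?_
      rw [← pow_add, Nat.sub_add_cancel (Nat.le_sub_one_of_lt (a i).2)]
    rw [this, mul_assoc]
    change _ * v a = 0
    rw [h0, mul_zero]
  rw [Fintype.linearIndependent_iff]
  intro g hg
  let Q : Polynomial k := ∑ j : Fin (p ^ r), Polynomial.C (g j) * Polynomial.X ^ (j : ℕ)
  have hQT : Polynomial.aeval T Q = ∑ j : Fin (p ^ r), g j • T ^ (j : ℕ) := by
    simp [Q, Algebra.smul_def]
  have hQ1 : Polynomial.aeval T Q 1 = 0 := by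
    rw [hQT]; simpa using hg
  have hQmem : Polynomial.aeval T Q ∈ Algebra.adjoin k (genL x y dx 1) := by
    rw [hQT]
    exact sum_mem fun j _ => Subalgebra.smul_mem _ (pow_mem hmem _) _
  have hQ0 : ∀ w, Polynomial.aeval T Q w = 0 := by
    intro w
    obtain ⟨R, hR⟩ := h.swap.exists_good b w
    have h1 := (h.commute_gen 1 hQmem (hR.mem 1)).eq
    have h2 := LinearMap.congr_fun h1 1
    simpa [hR.one, hQ1] using h2
  have hroot : ∀ a : Fin r → Fin p, Q.eval (∑ i, c i * ((a i : ℕ) : k)) = 0 := by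
    intro a
    have hev : Module.End.HasEigenvector T (∑ i, c i * ((a i : ℕ) : k)) (v a) :=
      Module.End.hasEigenvector_iff.mpr ⟨Module.End.mem_eigenspace_iff.mpr (hv a), hv0 a⟩
    have h1 := Module.End.aeval_apply_of_hasEigenvector (p := Q) hev
    rw [hQ0] at h1
    exact (smul_eq_zero.mp h1.symm).resolve_right (hv0 a)
  have hpr : 0 < p ^ r := pow_pos hp.pos r
  have hQz : Q = 0 := by
    refine Polynomial.eq_zero_of_natDegree_lt_card_of_eval_eq_zero Q hc hroot ?_
    rw [Fintype.card_fun, Fintype.card_fin, Fintype.card_fin]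
    refine lt_of_le_of_lt (Polynomial.natDegree_sum_le_of_forall_le (n := p ^ r - 1) _ _
      fun j _ => ?_) (Nat.sub_lt hpr one_pos)
    exact (Polynomial.natDegree_C_mul_X_pow_le _ _).trans (Nat.le_sub_one_of_lt j.2)
  intro j
  have h1 := congrArg (fun f => Polynomial.coeff f (j : ℕ)) hQz
  simp only [Q, Polynomial.finsetSum_coeff, Polynomial.coeff_C_mul, Polynomial.coeff_X_pow,
    Polynomial.coeff_zero, mul_ite, mul_one, mul_zero] at h1
  rw [Finset.sum_eq_single j] at h1
  · simpa using h1
  · intro i _ hi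
    rw [if_neg]
    intro h
    exact hi (Fin.ext h.symm)
  · simp

lemma WS.lower (h : WS x y dx dy) [Infinite k] (p : ℕ) (hp : p.Prime) [CharP k p]
    (hyp : ∀ i, y i ^ p = 0) (htop : (∏ i, x i ^ (p - 1)) * ∏ i, y i ^ (p - 1) ≠ 0)
    (b : Module.Basis ι k A) (f : A) (D : Module.End k A)
    (hD : ∀ g, D g = ∑ i, (dx i f * dy i g - dy i f * dx i g)) :
    p ^ r ≤ Module.finrank k (D.maxGenEigenspace 0) := by
  obtain ⟨f0, L0, hL0, hind⟩ := h.exists_regular p hp hyp htop b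
  obtain ⟨R0, hR0⟩ := h.swap.exists_good b f0
  obtain ⟨L, hL⟩ := h.exists_good b f
  obtain ⟨R, hR⟩ := h.swap.exists_good b f
  obtain ⟨E, hE, hE'⟩ := hL.exp
  obtain ⟨E2, hE2, hE2'⟩ := hR.exp
  obtain ⟨E0, hE0, hE0'⟩ := hL0.exp
  obtain ⟨E02, hE02, hE02'⟩ := hR0.exp
  let D0 : Module.End k A := (∑ i, LinearMap.mulLeft k (dx i f0) * (dy i : A →ₗ[k] A) : Module.End k A)
    - ∑ i, LinearMap.mulLeft k (dy i f0) * (dx i : A →ₗ[k] A)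
  have hD' : D = (∑ i, LinearMap.mulLeft k (dx i f) * (dy i : A →ₗ[k] A) : Module.End k A)
    - ∑ i, LinearMap.mulLeft k (dy i f) * (dx i : A →ₗ[k] A) := by
    ext g
    simp [hD, Finset.sum_sub_distrib]
  -- families
  let LL : k → Module.End k A := fun s => (L s - s • L s) + s • L0 s
  let RR : k → Module.End k A := fun s => (R s - s • R s) + s • R0 s
  let DD : k → Module.End k A := fun s => D + s • ((E2 s - E s) + D0 - D - s • (E2 s - E s)
    + s • (E02 s - E0 s))
  have hDD : ∀ s, RR s - LL s = s • DD s := by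
    intro s
    simp only [RR, LL, DD, hE', hE2', hE0', hE02', hD', D0]
    have em : LinearMap.mulLeft k f = LinearMap.mulLeft k f := rfl
    generalize (∑ i, LinearMap.mulLeft k (dx i f) * (dy i : A →ₗ[k] A) : Module.End k A) = a1
    generalize (∑ i, LinearMap.mulLeft k (dy i f) * (dx i : A →ₗ[k] A) : Module.End k A) = a2
    generalize (∑ i, LinearMap.mulLeft k (dx i f0) * (dy i : A →ₗ[k] A) : Module.End k A) = a3
    generalize (∑ i, LinearMap.mulLeft k (dy i f0) * (dx i : A →ₗ[k] A) : Module.End k A) = a4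
    module
  have pE := hE2.sub hE
  have hDDP : PFam b DD := (PFam.const D).add
    ((((pE.add (PFam.const D0)).sub (PFam.const D)).sub pE.smulX).add (hE02.sub hE0).smulX).smulX
  have hLLP : PFam b LL := (hL.pfam.sub hL.pfam.smulX).add hL0.pfam.smulX
  have hLmem : ∀ s, LL s ∈ Algebra.adjoin k (genL x y dx s) := fun s =>
    add_mem (sub_mem (hL.mem s) (Subalgebra.smul_mem _ (hL.mem s) s))
      (Subalgebra.smul_mem _ (hL0.mem s) s)
  have hRmem : ∀ s, RR s ∈ Algebra.adjoin k (genL y x dy s) := fun s =>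
    add_mem (sub_mem (hR.mem s) (Subalgebra.smul_mem _ (hR.mem s) s))
      (Subalgebra.smul_mem _ (hR0.mem s) s)
  have h0 : D = DD 0 := by simp [DD]
  rw [h0]
  refine hDDP.key hLLP 1 (p ^ r) ?_ ?_
  · have : LL 1 = L0 1 := by simp [LL]
    rw [this]; exact hind
  · intro s hs j
    have hcomm : Commute (RR s) (LL s ^ j) := ((h.commute_gen s (hLmem s) (hRmem s)).symm).pow_right j
    have h1 : RR s 1 = LL s 1 := by simp [RR, LL, hL.one, hR.one, hL0.one, hR0.one]
    have h2 : s • DD s ((LL s ^ j) 1) = 0 := by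
      rw [← LinearMap.smul_apply, ← hDD, LinearMap.sub_apply]
      have h3 := LinearMap.congr_fun hcomm.eq 1
      have h4 := LinearMap.congr_fun ((Commute.refl (LL s)).pow_right j).eq 1
      simp only [Module.End.mul_apply] at h3 h4
      rw [h3, h4, h1, sub_self]
    exact (smul_eq_zero.mp h2).resolve_left hs

end Lower

section Cartan

open LieAlgebra LieSubalgebra in
lemma cartan_eq_engel {k L : Type*} [Field k] [Infinite k] [LieRing L] [LieAlgebra k L]
    [Module.Finite k L] (H : LieSubalgebra k L) [H.IsCartanSubalgebra] :
    ∃ x, H = engel k x := by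
  have hle : ∀ x ∈ H, H ≤ engel k x := by
    intro x hx z hz
    rw [← zeroRootSubalgebra_eq_of_is_cartan k L H, mem_zeroRootSubalgebra] at hz
    obtain ⟨n, hn⟩ := hz ⟨x, hx⟩
    rw [mem_engel_iff]
    exact ⟨n, hn⟩
  obtain ⟨⟨x, hx⟩, hmin⟩ : ∃ x : H, ∀ y : H, Module.finrank k (engel k (x : L)) ≤
      Module.finrank k (engel k (y : L)) :=
    ⟨_, fun y => Function.argmin_le (fun x : H => Module.finrank k (engel k (x : L))) y⟩
  set Ex : {engel k z | z ∈ H} := ⟨engel k x, x, hx, rfl⟩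
  have hbot : IsBot Ex := by
    apply engel_isBot_of_isMin ((Cardinal.natCast_le_aleph0).trans (Cardinal.aleph0_le_mk k)) H Ex
      (hle x hx)
    rintro ⟨_, y, hy, rfl⟩ hyx
    suffices engel k y = engel k x from this.ge
    apply LieSubalgebra.toSubmodule_injective
    exact Submodule.eq_of_le_of_finrank_le hyx (hmin ⟨y, hy⟩)
  refine ⟨x, le_antisymm (hle x hx) fun z hz => ?_⟩
  rw [← zeroRootSubalgebra_eq_of_is_cartan k L H, mem_zeroRootSubalgebra]
  rintro ⟨y, hy⟩
  have h1 : engel k x ≤ engel k y := hbot ⟨engel k y, y, hy, rfl⟩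
  have h2 := h1 hz
  rw [mem_engel_iff] at h2
  exact h2

end Cartan

section Upper

variable {k A : Type*} [Field k] [CommRing A] [Algebra k A] {r : ℕ} {x y : Fin r → A}
    {dx dy : Fin r → Derivation k A A}

/-- monomials -/
def mono (x y : Fin r → A) (ac : (Fin r → ℕ) × (Fin r → ℕ)) : A :=
  (∏ i, x i ^ ac.1 i) * ∏ i, y i ^ ac.2 i

lemma mul_prod_pow (x : Fin r → A) (i : Fin r) (a : Fin r → ℕ) :
    x i * ∏ j, x j ^ a j = ∏ j, x j ^ (a j + if j = i then 1 else 0) := by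
  simp only [pow_add, Finset.prod_mul_distrib, pow_ite, pow_one, pow_zero,
    Finset.prod_ite_eq', Finset.mem_univ, if_true]
  ring

lemma WS.span_mono (h : WS x y dx dy) : Submodule.span k (Set.range (mono x y)) = ⊤ := by
  rw [eq_top_iff]
  rintro f -
  induction f using h.ind with
  | hc c =>
    rw [Algebra.algebraMap_eq_smul_one]
    exact Submodule.smul_mem _ _ (Submodule.subset_span ⟨(0, 0), by simp [mono]⟩)
  | ha f g hf hg => exact add_mem hf hg
  | hx i f hf =>
    have : Submodule.span k (Set.range (mono x y)) ≤
        (Submodule.span k (Set.range (mono x y))).comap (LinearMap.mulLeft k (x i)) := by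
      rw [Submodule.span_le]
      rintro _ ⟨⟨a, c⟩, rfl⟩
      exact Submodule.subset_span ⟨(fun j => a j + if j = i then 1 else 0, c), by
        simp only [mono, LinearMap.mulLeft_apply]
        rw [← mul_prod_pow, mul_assoc]⟩
    exact this hf
  | hy i f hf =>
    have : Submodule.span k (Set.range (mono x y)) ≤
        (Submodule.span k (Set.range (mono x y))).comap (LinearMap.mulLeft k (y i)) := by
      rw [Submodule.span_le]
      rintro _ ⟨⟨a, c⟩, rfl⟩
      exact Submodule.subset_span ⟨(a, fun j => c j + if j = i then 1 else 0), by
        simp only [mono, LinearMap.mulLeft_apply]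
        rw [← mul_prod_pow, mul_left_comm]⟩
    exact this hf

lemma prod_pow_zero {p : ℕ} (hxp : ∀ i, x i ^ p = 0) (a : Fin r → ℕ) (i : Fin r) (hi : p ≤ a i) :
    ∏ j, x j ^ a j = 0 :=
  Finset.prod_eq_zero (Finset.mem_univ i) (pow_eq_zero_of_le hi (hxp i))

lemma mono_cases {p : ℕ} (hxp : ∀ i, x i ^ p = 0) (hyp : ∀ i, y i ^ p = 0)
    (ac : (Fin r → ℕ) × (Fin r → ℕ)) :
    mono x y ac = 0 ∨ ((∀ i, ac.1 i < p) ∧ (∀ i, ac.2 i < p)) := by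
  by_cases h1 : ∀ i, ac.1 i < p
  · by_cases h2 : ∀ i, ac.2 i < p
    · exact Or.inr ⟨h1, h2⟩
    · push Not at h2
      obtain ⟨i, hi⟩ := h2
      left; rw [mono, prod_pow_zero hyp _ i hi, mul_zero]
  · push Not at h1
    obtain ⟨i, hi⟩ := h1
    left; rw [mono, prod_pow_zero hxp _ i hi, zero_mul]

lemma WS.finite (h : WS x y dx dy) {p : ℕ} (hxp : ∀ i, x i ^ p = 0) (hyp : ∀ i, y i ^ p = 0) :
    Module.Finite k A := by
  refine ⟨⟨((Set.finite_range (fun ac : (Fin r → Fin p) × (Fin r → Fin p) =>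
    mono x y (fun i => ac.1 i, fun i => ac.2 i))).toFinset), ?_⟩⟩
  rw [Set.Finite.coe_toFinset, eq_top_iff, ← h.span_mono, Submodule.span_le]
  rintro _ ⟨ac, rfl⟩
  rcases mono_cases hxp hyp ac with h0 | ⟨h1, h2⟩
  · rw [h0]; exact zero_mem _
  · exact Submodule.subset_span ⟨(fun i => ⟨_, h1 i⟩, fun i => ⟨_, h2 i⟩), rfl⟩

/-- `{·, v}` -/
def ham (dx dy : Fin r → Derivation k A A) (v : A) : Derivation k A A :=
  ∑ i, (dy i v • dx i - dx i v • dy i)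

lemma ham_apply (u v : A) : ham dx dy v u = ∑ i, (dx i u * dy i v - dy i u * dx i v) := by
  have : ∀ S : Finset (Fin r), (∑ i ∈ S, (dy i v • dx i - dx i v • dy i)) u =
      ∑ i ∈ S, (dx i u * dy i v - dy i u * dx i v) := by
    intro S
    induction S using Finset.induction_on with
    | empty => simp
    | insert a S ha ih =>
      rw [Finset.sum_insert ha, Finset.sum_insert ha, Derivation.add_apply, ih]
      simp
      ring
  exact this _

lemma ham_skew (u v : A) : ham dx dy v u = - ham dx dy u v := by
  rw [ham_apply, ham_apply, ← Finset.sum_neg_distrib]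
  exact Finset.sum_congr rfl fun i _ => by ring

lemma WS.ham_theta (h : WS x y dx dy) (i : Fin r) (g : A) :
    ham dx dy (x i * y i) g = x i * dx i g - y i * dy i g := by
  rw [ham_apply]
  simp [h.xx, h.xy, h.yx, h.yy, Finset.sum_sub_distrib]
  ring

lemma WS.ham_theta_theta (h : WS x y dx dy) (i j : Fin r) :
    ham dx dy (x i * y i) (x j * y j) = 0 := by
  rw [h.ham_theta]
  simp [h.xx, h.xy, h.yx, h.yy]
  split_ifs with hij
  · subst hij; ring
  · simp

lemma WS.ham_mono (h : WS x y dx dy) (i : Fin r) (ac : (Fin r → ℕ) × (Fin r → ℕ)) :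
    ham dx dy (x i * y i) (mono x y ac) = ((ac.1 i : k) - (ac.2 i : k)) • mono x y ac := by
  rw [h.ham_theta, mono]
  have e1 := der_euler dx x ac.1 h.xx i Finset.univ
  have e2 := der_prod_zero (dx i) y ac.2 (h.xy i) Finset.univ
  have e3 := der_euler dy y ac.2 h.yy i Finset.univ
  have e4 := der_prod_zero (dy i) x ac.1 (h.yx i) Finset.univ
  simp only [Finset.mem_univ, if_true] at e1 e3
  simp only [Derivation.leibniz, e2, e4, smul_eq_mul, mul_zero, zero_add, add_zero]
  rw [mul_left_comm (x i), e1, mul_left_comm (y i), e3, sub_smul, Nat.cast_smul_eq_nsmul,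
    Nat.cast_smul_eq_nsmul, nsmul_eq_mul, nsmul_eq_mul]
  ring

/-- the Cartan subspace -/
def H0 (k : Type*) {A : Type*} [Field k] [CommRing A] [Algebra k A] {r : ℕ} (p : ℕ)
    (x y : Fin r → A) : Submodule k A :=
  Submodule.span k (Set.range fun a : Fin r → Fin p => ∏ i, (x i * y i) ^ (a i : ℕ))

lemma finrank_H0 (p : ℕ) : Module.finrank k (H0 k p x y) ≤ p ^ r := by
  have := finrank_range_le_card (R := k) (fun a : Fin r → Fin p => ∏ i, (x i * y i) ^ (a i : ℕ))
  rw [Fintype.card_fun, Fintype.card_fin, Fintype.card_fin] at this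
  exact this

lemma mem_H0 {p : ℕ} (hxp : ∀ i, x i ^ p = 0) (a : Fin r → ℕ) :
    ∏ i, (x i * y i) ^ a i ∈ H0 k p x y := by
  by_cases h : ∀ i, a i < p
  · exact Submodule.subset_span ⟨fun i => ⟨_, h i⟩, rfl⟩
  · push Not at h
    obtain ⟨i, hi⟩ := h
    simp only [mul_pow, Finset.prod_mul_distrib]
    rw [prod_pow_zero hxp _ i hi, zero_mul]
    exact zero_mem _

lemma WS.H0_comm_theta (h : WS x y dx dy) {p : ℕ} (i : Fin r) {u : A} (hu : u ∈ H0 k p x y) :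
    ham dx dy (x i * y i) u = 0 := by
  suffices H0 k p x y ≤ LinearMap.ker (ham dx dy (x i * y i) : A →ₗ[k] A) from this hu
  rw [H0, Submodule.span_le]
  rintro _ ⟨a, rfl⟩
  exact der_prod_zero _ (fun i => x i * y i) _ (h.ham_theta_theta i) _

lemma WS.H0_comm (h : WS x y dx dy) {p : ℕ} {u v : A} (hu : u ∈ H0 k p x y)
    (hv : v ∈ H0 k p x y) : ham dx dy v u = 0 := by
  suffices H0 k p x y ≤ LinearMap.ker (ham dx dy v : A →ₗ[k] A) from this hu
  rw [H0, Submodule.span_le]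
  rintro _ ⟨a, rfl⟩
  refine der_prod_zero _ (fun i => x i * y i) _ (fun i => ?_) _
  rw [ham_skew, h.H0_comm_theta i hv, neg_zero]

lemma cast_pow_char {p : ℕ} (hp : p.Prime) [CharP k p] (a c : ℕ) :
    ((a : k) - (c : k)) ^ p = (a : k) - c := by
  have := Fact.mk hp
  rw [sub_pow_char]
  have := fun n : ℕ => map_natCast (frobenius k p) n
  simp only [frobenius_def] at this
  rw [this, this]

lemma WS.ham_pow_mono (h : WS x y dx dy) (i : Fin r) (ac : (Fin r → ℕ) × (Fin r → ℕ)) (n : ℕ) :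
    (((ham dx dy (x i * y i) : A →ₗ[k] A) : Module.End k A) ^ n) (mono x y ac) =
      ((ac.1 i : k) - (ac.2 i : k)) ^ n • mono x y ac := by
  induction n with
  | zero => simp
  | succ n ih =>
    rw [pow_succ, Module.End.mul_apply]
    have := h.ham_mono i ac
    rw [Derivation.coeFn_coe, this, map_smul, ih, smul_smul, pow_succ']

lemma WS.ham_pow (h : WS x y dx dy) {p : ℕ} (hp : p.Prime) [CharP k p] (i : Fin r) :
    ((ham dx dy (x i * y i) : A →ₗ[k] A) : Module.End k A) ^ p =
      (ham dx dy (x i * y i) : A →ₗ[k] A) := by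
  apply LinearMap.ext_on_range h.span_mono
  intro ac
  rw [h.ham_pow_mono, cast_pow_char hp, Derivation.coeFn_coe, h.ham_mono]

lemma WS.mem_H0_of (h : WS x y dx dy) {p : ℕ} (hp : p.Prime) [CharP k p]
    (hxp : ∀ i, x i ^ p = 0) (hyp : ∀ i, y i ^ p = 0) {f : A}
    (hf : ∀ i, ham dx dy (x i * y i) f = 0) : f ∈ H0 k p x y := by
  let E : Fin r → Module.End k A := fun i =>
    1 - ((ham dx dy (x i * y i) : A →ₗ[k] A) : Module.End k A) ^ (p - 1)
  have hp1 : p - 1 ≠ 0 := by have := hp.two_le; omega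
  have hE1 : ∀ l : List (Fin r), (l.map E).prod f = f := by
    intro l
    induction l with
    | nil => simp
    | cons i l ih =>
      rw [List.map_cons, List.prod_cons, Module.End.mul_apply, ih]
      obtain ⟨n, hn⟩ := Nat.exists_eq_succ_of_ne_zero hp1
      simp only [E, hn, pow_succ, Nat.succ_eq_add_one, LinearMap.sub_apply, Module.End.mul_apply,
        Derivation.coeFn_coe, hf, map_zero, sub_zero, Module.End.one_apply]
  have hE2 : ∀ (l : List (Fin r)) ac, (l.map E).prod (mono x y ac) =
      (l.map fun i => 1 - ((ac.1 i : k) - (ac.2 i : k)) ^ (p - 1)).prod • mono x y ac := by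
    intro l ac
    induction l with
    | nil => simp
    | cons i l ih =>
      rw [List.map_cons, List.prod_cons, Module.End.mul_apply, ih, map_smul, List.map_cons,
        List.prod_cons]
      simp only [E, LinearMap.sub_apply, h.ham_pow_mono, Module.End.one_apply]
      module
  have hE3 : (⊤ : Submodule k A) ≤ (H0 k p x y).comap ((List.finRange r).map E).prod := by
    rw [← h.span_mono, Submodule.span_le]
    rintro _ ⟨ac, rfl⟩
    rw [SetLike.mem_coe, Submodule.mem_comap, hE2]
    rcases mono_cases hxp hyp ac with h0 | ⟨h1, h2⟩
    · rw [h0, smul_zero]; exact zero_mem _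
    · by_cases hac : ac.1 = ac.2
      · apply Submodule.smul_mem
        have := mem_H0 (k := k) (y := y) hxp ac.1
        simp only [mul_pow, Finset.prod_mul_distrib] at this
        rw [mono, ← hac]
        exact this
      · obtain ⟨i, hi⟩ := Function.ne_iff.mp hac
        have hne : (ac.1 i : k) - (ac.2 i : k) ≠ 0 := by
          rw [sub_ne_zero, Ne, CharP.natCast_eq_natCast k p]
          exact fun hh => hi (Nat.ModEq.eq_of_lt_of_lt hh (h1 i) (h2 i))
        have h3 := cast_pow_char (k := k) hp (ac.1 i) (ac.2 i)
        have h4 : ((ac.1 i : k) - (ac.2 i : k)) ^ (p - 1) = 1 := by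
          apply mul_right_cancel₀ hne
          rw [← pow_succ, Nat.sub_add_cancel hp.one_le, h3, one_mul]
        rw [List.prod_eq_zero, zero_smul]
        · exact zero_mem _
        · rw [List.mem_map]
          exact ⟨i, List.mem_finRange i, by rw [h4, sub_self]⟩
  have := hE3 (Submodule.mem_top (x := f))
  rwa [Submodule.mem_comap, hE1] at this

lemma WS.lieRank_eq (h : WS x y dx dy) [Infinite k] {p : ℕ} (hp : p.Prime) [CharP k p]
    (hxp : ∀ i, x i ^ p = 0) (hyp : ∀ i, y i ^ p = 0)
    (htop : (∏ i, x i ^ (p - 1)) * ∏ i, y i ^ (p - 1) ≠ 0)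
    {P : Type*} [LieRing P] [LieAlgebra k P] (e : P ≃ₗ[k] A)
    (he : ∀ f g : P, e ⁅f, g⁆ = ∑ i, (dx i (e f) * dy i (e g) - dy i (e f) * dx i (e g))) :
    lieRank k P = p ^ r := by
  have hfin : Module.Finite k A := h.finite hxp hyp
  have hfinP : Module.Finite k P := Module.Finite.equiv e.symm
  have he' : ∀ f g : P, e ⁅f, g⁆ = ham dx dy (e g) (e f) := fun f g => by rw [he, ham_apply]
  -- lower bound
  have hlow : ∀ H : LieSubalgebra k P, H.IsCartanSubalgebra → p ^ r ≤ Module.finrank k H := by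
    intro H hH
    obtain ⟨f, rfl⟩ := cartan_eq_engel H
    have h1 := h.lower p hp hyp htop (Module.finBasis k A) (e f)
      (e.conj (LieAlgebra.ad k P f)) (fun g => by simp [LinearEquiv.conj_apply, he])
    rw [LinearMap.finrank_maxGenEigenspace_zero_eq, LinearEquiv.charpoly_conj,
      ← LinearMap.finrank_maxGenEigenspace_zero_eq] at h1
    exact h1
  -- the Cartan subalgebra
  let H : LieSubalgebra k P :=
    { (H0 k p x y).map (e.symm : A →ₗ[k] P) with
      lie_mem' := by
        intro u v hu hv
        change u ∈ (H0 k p x y).map (e.symm : A →ₗ[k] P) at hu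
        change v ∈ (H0 k p x y).map (e.symm : A →ₗ[k] P) at hv
        change ⁅u, v⁆ ∈ (H0 k p x y).map (e.symm : A →ₗ[k] P)
        rw [Submodule.mem_map_equiv] at hu hv ⊢
        simp only [LinearEquiv.symm_symm] at hu hv ⊢
        rw [he', h.H0_comm hu hv]
        exact zero_mem _ }
  have hmem : ∀ u, u ∈ H ↔ e u ∈ H0 k p x y := by
    intro u
    change u ∈ (H0 k p x y).map (e.symm : A →ₗ[k] P) ↔ _
    rw [Submodule.mem_map_equiv]
    simp only [LinearEquiv.symm_symm]
  have hab : IsLieAbelian H := by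
    refine ⟨fun u v => ?_⟩
    apply Subtype.ext
    apply e.injective
    rw [LieSubalgebra.coe_bracket, he', h.H0_comm ((hmem _).mp u.2) ((hmem _).mp v.2)]
    simp
  have hth : ∀ i, x i * y i ∈ H0 k p x y := by
    intro i
    have := mem_H0 (k := k) (y := y) hxp (fun j => if j = i then 1 else 0)
    simpa [pow_ite] using this
  have hCar : H.IsCartanSubalgebra := by
    refine ⟨inferInstance, le_antisymm (fun u hu => ?_) (LieSubalgebra.le_normalizer H)⟩
    rw [LieSubalgebra.mem_normalizer_iff] at hu
    rw [hmem]
    apply h.mem_H0_of hp hxp hyp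
    intro i
    have h1 := hu (e.symm (x i * y i)) ((hmem _).mpr (by simpa using hth i))
    rw [hmem, he', LinearEquiv.apply_symm_apply] at h1
    have h2 := h.H0_comm_theta i h1
    have h3 := LinearMap.congr_fun (h.ham_pow hp i) (e u)
    obtain ⟨n, hn⟩ := Nat.exists_eq_add_of_le hp.two_le
    have h4 : ∀ T : Module.End k A, T ^ p = T ^ n * (T * T) := by
      intro T; rw [hn, add_comm, pow_add, pow_two]
    rw [h4] at h3
    simp only [Module.End.mul_apply, Derivation.coeFn_coe, h2, map_zero] at h3
    exact h3.symm
  have hrk : Module.finrank k H ≤ p ^ r :=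
    (Submodule.finrank_map_le (e.symm : A →ₗ[k] P) (H0 k p x y)).trans (finrank_H0 p)
  have heq : Module.finrank k H = p ^ r := le_antisymm hrk (hlow H hCar)
  apply le_antisymm
  · exact Nat.sInf_le ⟨H, hCar, heq⟩
  · refine le_csInf (s := {d : ℕ | ∃ H : LieSubalgebra k P, H.IsCartanSubalgebra ∧
      Module.finrank k H = d}) ⟨_, H, hCar, heq⟩ ?_
    rintro _ ⟨H', hH', rfl⟩
    exact hlow H' hH'

end Upper

section Inst

lemma poissonWS (p : ℕ) (hp : p.Prime) (k : Type*) [Field k] [CharP k p] (r : ℕ) :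
    WS (k := k) (fun i : Fin r => truncX p k (2 * r) ⟨i.1, by have := i.isLt; omega⟩)
      (fun i : Fin r => truncX p k (2 * r) ⟨i.1 + r, by have := i.isLt; omega⟩)
      (fun i : Fin r => truncPD p k (2 * r) ⟨i.1, by have := i.isLt; omega⟩)
      (fun i : Fin r => truncPD p k (2 * r) ⟨i.1 + r, by have := i.isLt; omega⟩) := by
  have key : ∀ i j : Fin (2 * r), truncPD p k (2 * r) i (truncX p k (2 * r) j) =
      if i = j then 1 else 0 := by
    intro i j
    change Ideal.Quotient.mk (truncIdeal p k (2 * r)) (MvPolynomial.pderiv i (MvPolynomial.X j)) = _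
    rw [MvPolynomial.pderiv_X, Pi.single_apply]
    by_cases h : i = j
    · simp [h]
    · rw [if_neg (Ne.symm h), if_neg h, map_zero]
  refine ⟨?_, ?_, ?_, ?_, ?_⟩
  · intro i j
    rw [key]; simp [Fin.ext_iff]
  · intro i j
    rw [key, if_neg]
    have := i.2
    simp only [Fin.ext_iff]; omega
  · intro i j
    rw [key, if_neg]
    have := j.2
    simp only [Fin.ext_iff]; omega
  · intro i j
    rw [key]; simp [Fin.ext_iff]
  · rw [eq_top_iff]
    rintro f -
    obtain ⟨f, rfl⟩ := Ideal.Quotient.mk_surjective f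
    induction f using MvPolynomial.induction_on with
    | C a => exact Subalgebra.algebraMap_mem _ a
    | add f g hf hg => rw [map_add]; exact add_mem hf hg
    | mul_X f n hf =>
      rw [map_mul]
      refine mul_mem hf (Algebra.subset_adjoin ?_)
      by_cases hn : n.1 < r
      · exact Or.inl ⟨⟨n.1, hn⟩, rfl⟩
      · refine Or.inr ⟨⟨n.1 - r, by have := n.2; omega⟩, ?_⟩
        have : (⟨n.1 - r + r, by have := n.2; omega⟩ : Fin (2 * r)) = n :=
          Fin.ext (by simp only; omega)
        simp only [this]
        rfl

lemma truncX_pow (p : ℕ) (k : Type*) [Field k] (n : ℕ) (i : Fin n) :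
    truncX p k n i ^ p = 0 := by
  rw [truncX, ← map_pow, Ideal.Quotient.eq_zero_iff_mem]
  exact Ideal.subset_span ⟨i, rfl⟩

lemma trunc_top (p : ℕ) (hp : p.Prime) (k : Type*) [Field k] (r : ℕ) :
    (∏ i : Fin r, truncX p k (2 * r) ⟨i.1, by have := i.isLt; omega⟩ ^ (p - 1)) *
      ∏ i : Fin r, truncX p k (2 * r) ⟨i.1 + r, by have := i.isLt; omega⟩ ^ (p - 1) ≠ 0 := by
  classical
  intro h0
  let m : Fin (2 * r) →₀ ℕ :=
    (∑ i : Fin r, Finsupp.single (⟨i.1, by have := i.isLt; omega⟩ : Fin (2 * r)) (p - 1)) +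
      ∑ i : Fin r, Finsupp.single (⟨i.1 + r, by have := i.isLt; omega⟩ : Fin (2 * r)) (p - 1)
  have hmk : Ideal.Quotient.mk (truncIdeal p k (2 * r)) (MvPolynomial.monomial m 1) = 0 := by
    rw [← h0]
    simp only [truncX, ← map_pow, ← map_prod, ← map_mul]
    congr 1
    simp only [MvPolynomial.X_pow_eq_monomial, ← MvPolynomial.monomial_sum_one,
      MvPolynomial.monomial_mul, mul_one, m]
  rw [Ideal.Quotient.eq_zero_iff_mem] at hmk
  have hset : {f | ∃ i : Fin (2 * r), f = (MvPolynomial.X i : MvPolynomial (Fin (2 * r)) k) ^ p} =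
      (fun s => MvPolynomial.monomial s (1 : k)) ''
        (Set.range fun i : Fin (2 * r) => Finsupp.single i p) := by
    ext f
    simp only [Set.mem_setOf_eq, Set.mem_image, Set.exists_range_iff,
      MvPolynomial.X_pow_eq_monomial, eq_comm]
  rw [truncIdeal, hset, MvPolynomial.mem_ideal_span_monomial_image] at hmk
  obtain ⟨_, ⟨j, rfl⟩, hj⟩ := hmk m (by simp [MvPolynomial.mem_support_iff])
  have h1 := hj j
  rw [Finsupp.single_eq_same] at h1
  have h2 : m j ≤ p - 1 := by
    simp only [m, Finsupp.add_apply, Finsupp.finsetSum_apply, Finsupp.single_apply]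
    by_cases hn : j.1 < r
    · rw [Finset.sum_eq_single (⟨j.1, hn⟩ : Fin r), Finset.sum_eq_zero]
      · simp
      · intro i _
        rw [if_neg]; simp only [Fin.ext_iff]; omega
      · intro i _ hi
        rw [if_neg]; simpa [Fin.ext_iff] using hi
      · simp
    · rw [Finset.sum_eq_zero, Finset.sum_eq_single (⟨j.1 - r, by have := j.2; omega⟩ : Fin r)]
      · split_ifs <;> simp
      · intro i _ hi
        rw [if_neg]
        simp only [Fin.ext_iff, ne_eq] at hi ⊢; omega
      · simp
      · intro i _
        rw [if_neg]; have := i.2; simp only [Fin.ext_iff]; omega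
  have := hp.two_le
  omega

end Inst


/-- Proposition 3.2(2).  Let `P(2r)` be the restricted Poisson algebra:
the space `A(2r)` endowed with the Poisson bracket and a restricted structure whose
center `k·1` is toral (`1^{[p]} = 1`).  Then `rk(P(2r)) = p^r`. -/
theorem lieRank_poisson (p : ℕ) (hp : p.Prime) (hp3 : 3 ≤ p)
    (k : Type*) [Field k] [IsAlgClosed k] [CharP k p]
    (r : ℕ) (hr : 1 ≤ r)
    (P : Type*) [LieRing P] [LieAlgebra k P]
    (e : P ≃ₗ[k] TruncPoly p k (2 * r))
    (he : ∀ f g : P, e ⁅f, g⁆ = poissonBracket p k r (e f) (e g))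
    (op : P → P) (hop : IsPMap p k op)
    (htoral : op (e.symm 1) = e.symm 1) :
    lieRank k P = p ^ r := by
  have : Infinite k := IsAlgClosed.instInfinite
  refine (poissonWS p hp k r).lieRank_eq hp (fun i => truncX_pow p k _ _)
    (fun i => truncX_pow p k _ _) (trunc_top p hp k r) e (fun f g => ?_)
  rw [he]
  rfl
end

section
/- Let n = 2r + 1 with n + 3 ≢ 0 (mod p), and let K''(n) = K(n) be the restricted contact algebra. Then rk(K''(n)) = p^r. -/
/-!
The truncated polynomial ring `A(n) = k[X₁,…,Xₙ]/(X₁^p,…,Xₙ^p)`, its partial derivatives,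
the Jacobson–Witt algebra `W(n) = Der(A(n))`, and related Lie algebras of Cartan type.
-/

set_option synthInstance.maxHeartbeats 1000000
set_option maxHeartbeats 1600000

section CartanAlgebras

variable (p : ℕ) (k : Type*) [Field k] [CharP k p]

/-- The restricted Jacobson–Witt algebra `W(n) := Der(A(n))`. -/
noncomputable abbrev WittAlg (n : ℕ) :=
  Derivation k (TruncPoly p k n) (TruncPoly p k n)

/-- The divergence of a derivation `D = ∑ fᵢ ∂ᵢ`, namely `∑ ∂ᵢ(fᵢ) = ∑ ∂ᵢ(D(xᵢ))`. -/
noncomputable def divergence (n : ℕ) (D : WittAlg p k n) : TruncPoly p k n :=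
  ∑ i : Fin n, truncPD p k n i (D (truncX p k n i))

/-- The linear embedding of `W(n)` into the associative algebra of `k`-linear
endomorphisms of `A(n)`; the `p`-map of `W(n)` is `D ↦ D^p` under this embedding. -/
noncomputable def derToEnd (n : ℕ) :
    WittAlg p k n →ₗ[k] Module.End k (TruncPoly p k n) where
  toFun D := D.toLinearMap
  map_add' := fun _ _ => rfl
  map_smul' := fun _ _ => rfl

/-- The Hamiltonian map `D_H : A(2r) → W(2r)`,
`f ↦ ∑ᵢ (∂ᵢ(f) ∂_{i+r} − ∂_{i+r}(f) ∂ᵢ)`. -/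
noncomputable def DH (r : ℕ) (f : TruncPoly p k (2 * r)) : WittAlg p k (2 * r) :=
  ∑ i : Fin r,
    (truncPD p k (2 * r) ⟨i.1, by have := i.isLt; omega⟩ f •
        truncPD p k (2 * r) ⟨i.1 + r, by have := i.isLt; omega⟩
      - truncPD p k (2 * r) ⟨i.1 + r, by have := i.isLt; omega⟩ f •
        truncPD p k (2 * r) ⟨i.1, by have := i.isLt; omega⟩)

/-- The contact map `D_K : A(2r+1) → W(2r+1)` (Strade–Farnsteiner, §4.5). -/
noncomputable def DK (r : ℕ) (f : TruncPoly p k (2 * r + 1)) : WittAlg p k (2 * r + 1) :=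
  (∑ i : Fin r,
    ((truncX p k (2 * r + 1) ⟨i.1, by have := i.isLt; omega⟩ *
        truncPD p k (2 * r + 1) (Fin.last (2 * r)) f
      - truncPD p k (2 * r + 1) ⟨i.1 + r, by have := i.isLt; omega⟩ f) •
        truncPD p k (2 * r + 1) ⟨i.1, by have := i.isLt; omega⟩
    + (truncX p k (2 * r + 1) ⟨i.1 + r, by have := i.isLt; omega⟩ *
        truncPD p k (2 * r + 1) (Fin.last (2 * r)) f
      + truncPD p k (2 * r + 1) ⟨i.1, by have := i.isLt; omega⟩ f) •
        truncPD p k (2 * r + 1) ⟨i.1 + r, by have := i.isLt; omega⟩))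
  + ((2 : TruncPoly p k (2 * r + 1)) * f
      - ∑ i : Fin (2 * r), truncX p k (2 * r + 1) ⟨i.1, by have := i.isLt; omega⟩ *
          truncPD p k (2 * r + 1) ⟨i.1, by have := i.isLt; omega⟩ f) •
      truncPD p k (2 * r + 1) (Fin.last (2 * r))

/-- The derived subalgebra `[K, K]` of a Lie subalgebra. -/
noncomputable def derivedSub {L : Type*} [LieRing L] [LieAlgebra k L]
    (K : LieSubalgebra k L) : LieSubalgebra k L :=
  LieSubalgebra.lieSpan k L {z | ∃ x ∈ K, ∃ y ∈ K, z = ⁅x, y⁆}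

/-- `K''(2r+1) = {D ∈ W(n) | D(ω_K) ∈ A(n)·ω_K}`, realized as the image of `D_K`. -/
noncomputable def contactAmbient (r : ℕ) : LieSubalgebra k (WittAlg p k (2 * r + 1)) :=
  LieSubalgebra.lieSpan k _ (Set.range (DK p k r))

/-- The restricted contact algebra `K(2r+1) := [K''(2r+1), K''(2r+1)]`. -/
noncomputable def contactAlg (r : ℕ) : LieSubalgebra k (WittAlg p k (2 * r + 1)) :=
  derivedSub k (contactAmbient p k r)

/-- `H'(2r) := D_H(A(2r))`, the image of the Hamiltonian map. -/
noncomputable def hamiltonianAmbient (r : ℕ) : LieSubalgebra k (WittAlg p k (2 * r)) :=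
  LieSubalgebra.lieSpan k _ (Set.range (DH p k r))

/-- The restricted Hamiltonian algebra `H(2r) := H'(2r)^{(1)}`. -/
noncomputable def hamiltonianAlg (r : ℕ) : LieSubalgebra k (WittAlg p k (2 * r)) :=
  derivedSub k (hamiltonianAmbient p k r)

/-- `S̃(n) := {D ∈ W(n) | div(D) = 0}`. -/
noncomputable def specialAmbient (n : ℕ) : LieSubalgebra k (WittAlg p k n) :=
  LieSubalgebra.lieSpan k _ {D | divergence p k n D = 0}

/-- The restricted special algebra `S(n) := S̃(n)^{(1)}`. -/
noncomputable def specialAlg (n : ℕ) : LieSubalgebra k (WittAlg p k n) :=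
  derivedSub k (specialAmbient p k n)

/-- A torus of a `p`-subalgebra `K` of the Jacobson–Witt algebra `W(n)` (whose `p`-map is
`D ↦ D^p`, the `p`-th power in `End_k(A(n))`): a subalgebra of `K` closed under the
`p`-power map and consisting of semisimple elements. -/
def IsTorusIn (n : ℕ) (K : LieSubalgebra k (WittAlg p k n))
    (T : Submodule k (WittAlg p k n)) : Prop :=
  (∀ x ∈ T, x ∈ K) ∧
  (∀ x ∈ T, ∀ y ∈ T, ⁅x, y⁆ ∈ T) ∧
  (∀ x ∈ T, ∃ y ∈ T, derToEnd p k n y = (derToEnd p k n x) ^ p) ∧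
  (∀ x ∈ T, derToEnd p k n x ∈ Submodule.span k
    {z : Module.End k (TruncPoly p k n) | ∃ m : ℕ, 1 ≤ m ∧ z = (derToEnd p k n x) ^ (p ^ m)})

/-- `μ(K)`: the maximal dimension of a torus of `K ⊆ W(n)`. -/
noncomputable def muIn (n : ℕ) (K : LieSubalgebra k (WittAlg p k n)) : ℕ :=
  sSup {d : ℕ | ∃ T : Submodule k (WittAlg p k n),
    IsTorusIn p k n K T ∧ Module.finrank k T = d}

end CartanAlgebras

/-- The rank of a Lie subalgebra `K`: the minimal dimension of a Cartan subalgebra of the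
Lie algebra `K`. -/
noncomputable def lieRankOf (k : Type*) [Field k] {L : Type*} [LieRing L] [LieAlgebra k L]
    (K : LieSubalgebra k L) : ℕ :=
  sInf {d : ℕ | ∃ H : LieSubalgebra k K, H.IsCartanSubalgebra ∧ Module.finrank k H = d}


open Module LieAlgebra LieSubalgebra in
theorem aux_cartan (k : Type*) [Field k] [Infinite k] (L : Type*) [LieRing L] [LieAlgebra k L]
    [Module.Finite k L] (d : ℕ) (hd : LieAlgebra.rank k L = d) :
    sInf {d : ℕ | ∃ H : LieSubalgebra k L, H.IsCartanSubalgebra ∧ Module.finrank k H = d} = d := by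
  have hcard : (finrank k L : Cardinal) ≤ Cardinal.mk k :=
    Cardinal.natCast_le_aleph0.trans <| Cardinal.infinite_iff.mp ‹Infinite k›
  apply le_antisymm
  · apply Nat.sInf_le
    obtain ⟨x, hx⟩ := LieAlgebra.exists_isRegular k L
    refine ⟨engel k x, ⟨?_, normalizer_engel _ _⟩, by
      rw [← hd]; exact (isRegular_iff_finrank_engel_eq_rank k x).1 hx⟩
    apply isNilpotent_of_forall_le_engel
    intro y hy
    set Ex : {engel k z | z ∈ engel k x} := ⟨engel k x, x, self_mem_engel _ _, rfl⟩
    suffices IsBot Ex from @this ⟨engel k y, y, hy, rfl⟩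
    apply engel_isBot_of_isMin hcard (engel k x) Ex le_rfl
    rintro ⟨_, y, hy, rfl⟩ hyx
    suffices finrank k (engel k x) ≤ finrank k (engel k y) by
      suffices engel k y = engel k x from this.ge
      apply LieSubalgebra.toSubmodule_injective
      exact Submodule.eq_of_le_of_finrank_le hyx this
    rw [(isRegular_iff_finrank_engel_eq_rank k x).mp hx]
    apply rank_le_finrank_engel
  · have hne : {d : ℕ | ∃ H : LieSubalgebra k L, H.IsCartanSubalgebra ∧ finrank k H = d}.Nonempty := by
      obtain ⟨x, hx⟩ := LieAlgebra.exists_isCartanSubalgebra_engel k L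
      exact ⟨_, _, hx, rfl⟩
    apply le_csInf hne
    rintro _ ⟨H, hH, rfl⟩
    have hle : ∀ x ∈ H, H ≤ engel k x := by
      intro x hx y hy
      have h1 := le_zeroRootSubalgebra k L H hy
      rw [mem_zeroRootSubalgebra] at h1
      rw [mem_engel_iff]
      obtain ⟨n, hn⟩ := h1 ⟨x, hx⟩
      exact ⟨n, hn⟩
    have : ∃ x ∈ H, ∀ y ∈ H, finrank k (engel k x) ≤ finrank k (engel k y) := by
      have hn : {n | ∃ x ∈ H, finrank k (engel k x) = n}.Nonempty := ⟨_, 0, H.zero_mem, rfl⟩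
      obtain ⟨x, hx, h⟩ := Nat.sInf_mem hn
      refine ⟨x, hx, fun y hy => ?_⟩
      rw [h]
      exact Nat.sInf_le ⟨y, hy, rfl⟩
    obtain ⟨x, hx, hmin⟩ := this
    set Ex : {engel k z | z ∈ H} := ⟨engel k x, x, hx, rfl⟩
    have hbot : IsBot Ex := by
      apply engel_isBot_of_isMin hcard H Ex (hle x hx)
      rintro ⟨_, y, hy, rfl⟩ hyx
      suffices engel k y = engel k x from this.ge
      apply LieSubalgebra.toSubmodule_injective
      exact Submodule.eq_of_le_of_finrank_le hyx (hmin y hy)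
    have hEH : engel k x ≤ H := by
      intro z hz
      rw [← zeroRootSubalgebra_eq_of_is_cartan k L H, mem_zeroRootSubalgebra]
      rintro ⟨y, hy⟩
      have h2 : engel k x ≤ engel k y := @hbot ⟨engel k y, y, hy, rfl⟩
      have h3 := h2 hz
      rw [mem_engel_iff] at h3
      obtain ⟨n, hn⟩ := h3
      exact ⟨n, hn⟩
    rw [← hd]
    exact (rank_le_finrank_engel k x).trans (Submodule.finrank_mono (s := (engel k x).toSubmodule) (t := H.toSubmodule) hEH)

open Module LieAlgebra LieSubalgebra in
theorem aux_rank (k : Type*) [Field k] [Infinite k] (L : Type*) [LieRing L] [LieAlgebra k L]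
    [Module.Finite k L] (d : ℕ) (x0 : L) (h1 : finrank k (engel k x0) ≤ d)
    (h2 : ∀ y : L, ∃ Q : Polynomial k, Q ≠ 0 ∧ ∀ s : k, Q.eval s ≠ 0 →
      d ≤ finrank k (engel k (x0 + s • y))) : LieAlgebra.rank k L = d := by
  classical
  apply le_antisymm ((rank_le_finrank_engel k x0).trans h1)
  obtain ⟨x, hx⟩ := LieAlgebra.exists_isRegular k L
  let b := Module.Free.chooseBasis k L
  obtain ⟨P, hP⟩ : ∃ P, ∀ x : L, IsRegular k x ↔ MvPolynomial.eval (b.repr x) P ≠ 0 :=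
    ⟨_, fun x => isRegular_iff_coeff_polyCharpoly_rank_ne_zero k b x⟩
  rw [hP] at hx
  obtain ⟨Q, hQ, h2⟩ := h2 (x - x0)
  let q : Polynomial k := MvPolynomial.aeval
    (fun i => Polynomial.C (b.repr (x - x0) i) * Polynomial.X + Polynomial.C (b.repr x0 i)) P
  have hq : ∀ s : k, q.eval s = MvPolynomial.eval (b.repr (x0 + s • (x - x0))) P := by
    intro s
    have : (b.repr (x0 + s • (x - x0)) : _ → k) = fun i =>
      Polynomial.aeval s (Polynomial.C (b.repr (x - x0) i) * Polynomial.X + Polynomial.C (b.repr x0 i)) := by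
      ext i; simp; ring
    rw [this, ← Polynomial.coe_aeval_eq_eval]
    simp only [q]
    rw [MvPolynomial.comp_aeval_apply]
    rfl
  have hq0 : q ≠ 0 := by
    intro h
    apply hx
    have := hq 1
    rw [h] at this
    simpa using this.symm
  obtain ⟨s, hs⟩ : ∃ s, (Q * q).eval s ≠ 0 := by
    by_contra! h
    exact mul_ne_zero hQ hq0 (Polynomial.funext (by simpa using h))
  rw [Polynomial.eval_mul] at hs
  have hreg : IsRegular k (x0 + s • (x - x0)) := by
    rw [hP, ← hq]
    exact right_ne_zero_of_mul hs
  rw [← (isRegular_iff_finrank_engel_eq_rank k _).1 hreg]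
  exact h2 s (left_ne_zero_of_mul hs)

section Gen
variable {k A σ : Type*} [Field k] [CommRing A] [Algebra k A]

theorem aux_sum_apply {τ : Type*} (s : Finset τ) (D : τ → Derivation k A A) (a : A) :
    (∑ i ∈ s, D i) a = ∑ i ∈ s, D i a := by
  classical
  induction s using Finset.induction_on with
  | empty => simp
  | insert b s hb ih => rw [Finset.sum_insert hb, Finset.sum_insert hb, Derivation.add_apply, ih]

theorem aux_der_prod [Fintype σ] (T : Derivation k A A) (h w : σ → A) (hT : ∀ j, T (h j) = w j * h j)
    (e : σ → ℕ) : T (∏ j, h j ^ e j) = (∑ j, (e j : A) * w j) * ∏ j, h j ^ e j := by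
  classical
  suffices H : ∀ s : Finset σ, T (∏ j ∈ s, h j ^ e j) = (∑ j ∈ s, (e j : A) * w j) * ∏ j ∈ s, h j ^ e j from
    H Finset.univ
  intro s
  induction s using Finset.induction_on with
  | empty => simp
  | insert a s ha ih =>
    rw [Finset.prod_insert ha, Finset.sum_insert ha, Derivation.leibniz, ih, Derivation.leibniz_pow, hT]
    simp only [smul_eq_mul, nsmul_eq_mul]
    rcases Nat.eq_zero_or_pos (e a) with h0 | h0
    · simp [h0]
    · obtain ⟨m, hm⟩ := Nat.exists_eq_succ_of_ne_zero h0.ne'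
      rw [hm]; simp only [Nat.succ_eq_add_one, Nat.add_sub_cancel, pow_succ]; ring

theorem aux_pow_zero (p : ℕ) [CharP k p] (E : Derivation k A A) (h a : A) (hE : E h = 1) (ha : E a = 0)
    (e : ℕ) (he : e < p) (h0 : a * h ^ e = 0) : a = 0 := by
  induction e with
  | zero => simpa using h0
  | succ m ih =>
    apply ih (by omega)
    have := congrArg E h0
    rw [Derivation.leibniz, Derivation.leibniz_pow, ha, hE, map_zero] at this
    simp only [smul_eq_mul, nsmul_eq_mul, mul_zero, add_zero, mul_one, Nat.add_sub_cancel] at this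
    have hne : ((m + 1 : ℕ) : k) ≠ 0 := by
      rw [Ne, CharP.cast_eq_zero_iff k p]
      exact Nat.not_dvd_of_pos_of_lt (by omega) he
    have h3 : ((m + 1 : ℕ) : k) • (a * h ^ m) = 0 := by
      rw [Algebra.smul_def, map_natCast, ← this]; ring
    exact (smul_eq_zero.1 h3).resolve_left hne

theorem aux_prod_ne [Fintype σ] [DecidableEq σ] [Nontrivial A] (p : ℕ) [CharP k p] (E : σ → Derivation k A A) (h : σ → A)
    (hE : ∀ i j, E i (h j) = if i = j then 1 else 0) (e : σ → ℕ) (he : ∀ j, e j < p) :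
    ∏ j, h j ^ e j ≠ 0 := by
  suffices H : ∀ s : Finset σ, ∏ j ∈ s, h j ^ e j ≠ 0 from H Finset.univ
  intro s
  induction s using Finset.induction_on with
  | empty => simp
  | insert a s ha ih =>
    rw [Finset.prod_insert ha, mul_comm]
    intro h0
    apply ih
    refine aux_pow_zero p (E a) (h a) _ (by simp [hE]) ?_ _ (he a) h0
    clear h0 ih
    induction s using Finset.induction_on with
    | empty => simp
    | insert b s hb ih2 =>
      rw [Finset.mem_insert, not_or] at ha
      rw [Finset.prod_insert hb, Derivation.leibniz, ih2 ha.2, Derivation.leibniz_pow, hE, if_neg ha.1]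
      simp

theorem aux_exists_indep (p : ℕ) (hp : p.Prime) (k : Type*) [Field k] [CharP k p] [Infinite k]
    (σ : Type*) [Fintype σ] : ∃ β : σ → k, ∀ c : σ → ℤ, ∑ j, (c j : k) * β j = 0 → ∀ j, (p : ℤ) ∣ c j := by
  have := Fact.mk hp
  let : Algebra (ZMod p) k := ZMod.algebra k p
  have key : ∀ n : ℕ, ∃ β : Fin n → k, LinearIndependent (ZMod p) β := by
    intro n
    have hnf : ¬ Module.Finite (ZMod p) k := by
      intro h
      have : Finite k := Module.finite_of_finite (ZMod p)
      exact not_finite k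
    have h1 : Cardinal.aleph0 ≤ Module.rank (ZMod p) k := by
      by_contra h
      exact hnf (Module.rank_lt_aleph0_iff.1 (not_le.1 h))
    induction n with
    | zero => exact ⟨Fin.elim0, linearIndependent_empty_type⟩
    | succ n ih =>
      obtain ⟨v, hv⟩ := ih
      obtain ⟨x, hx⟩ := exists_linearIndependent_cons_of_lt_rank hv ((Cardinal.natCast_lt_aleph0).trans_le h1)
      exact ⟨_, hx⟩
  obtain ⟨β, hβ⟩ := key (Fintype.card σ)
  refine ⟨β ∘ Fintype.equivFin σ, fun c hc j => ?_⟩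
  have h2 : LinearIndependent (ZMod p) (β ∘ Fintype.equivFin σ) := hβ.comp _ (Fintype.equivFin σ).injective
  rw [Fintype.linearIndependent_iff] at h2
  have := h2 (fun j => (c j : ZMod p)) (by
    rw [← hc]
    refine Finset.sum_congr rfl fun i _ => ?_
    rw [Algebra.smul_def]; simp) j
  exact (ZMod.intCast_zmod_eq_zero_iff_dvd _ _).1 this

theorem aux_linind [Fintype σ] [DecidableEq σ] [Nontrivial A] (p : ℕ) (hp : p.Prime) [CharP k p] [Infinite k]
    (E : σ → Derivation k A A) (h : σ → A)
    (hE : ∀ i j, E i (h j) = if i = j then 1 else 0) :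
    LinearIndependent k (fun e : σ → Fin p => ∏ j, h j ^ (e j : ℕ)) := by
  obtain ⟨β, hβ⟩ := aux_exists_indep p hp k σ
  let T : Derivation k A A := ∑ i, (β i • h i) • E i
  have hT : ∀ j, T (h j) = algebraMap k A (β j) * h j := by
    intro j
    simp [T, aux_sum_apply, hE, Algebra.smul_def]
  refine Module.End.eigenvectors_linearIndependent' (T : A →ₗ[k] A) (fun e : σ → Fin p => ∑ j, ((e j : ℕ) : k) * β j) ?_ _ ?_
  · intro e e' hee
    ext j
    have := hβ (fun j => ((e j : ℕ) : ℤ) - ((e' j : ℕ) : ℤ)) (by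
      have hee' : ∑ j, ((e j : ℕ) : k) * β j = ∑ j, ((e' j : ℕ) : k) * β j := hee
      push_cast
      simp only [sub_mul, Finset.sum_sub_distrib]
      exact sub_eq_zero.2 hee') j
    have h1 := (e j).isLt
    have h2 := (e' j).isLt
    have := Int.eq_zero_of_abs_lt_dvd this (by rw [abs_lt]; omega)
    omega
  · intro e
    rw [Module.End.hasEigenvector_iff, Module.End.mem_eigenspace_iff]
    refine ⟨?_, aux_prod_ne p E h hE _ (fun j => (e j).isLt)⟩
    show T _ = _
    rw [aux_der_prod T h _ hT, Algebra.smul_def]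
    simp

theorem aux_span [Fintype σ] (p : ℕ) (hp : p.Prime) (h : σ → A) (c : σ → k)
    (hc : ∀ j, h j ^ p = algebraMap k A (c j)) (hg : Algebra.adjoin k (Set.range h) = ⊤) :
    ⊤ ≤ Submodule.span k (Set.range (fun e : σ → Fin p => ∏ j, h j ^ (e j : ℕ))) := by
  have key : ∀ n : σ → ℕ, ∏ j, h j ^ n j ∈ Submodule.span k (Set.range (fun e : σ → Fin p => ∏ j, h j ^ (e j : ℕ))) := by
    intro n
    have : ∏ j, h j ^ n j = (∏ j, c j ^ (n j / p)) • ∏ j, h j ^ ((⟨n j % p, Nat.mod_lt _ hp.pos⟩ : Fin p) : ℕ) := by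
      rw [Algebra.smul_def, map_prod, ← Finset.prod_mul_distrib]
      refine Finset.prod_congr rfl fun j _ => ?_
      rw [map_pow, ← hc, ← pow_mul, ← pow_add]
      congr 1
      exact (Nat.div_add_mod _ _).symm
    rw [this]
    exact Submodule.smul_mem _ _ (Submodule.subset_span ⟨fun j => ⟨n j % p, Nat.mod_lt _ hp.pos⟩, rfl⟩)
  intro a _
  have ha : a ∈ Algebra.adjoin k (Set.range h) := by rw [hg]; trivial
  rw [Algebra.adjoin_range_eq_range_aeval] at ha
  obtain ⟨P, rfl⟩ := ha
  show MvPolynomial.aeval h P ∈ _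
  rw [MvPolynomial.as_sum P, map_sum]
  refine Submodule.sum_mem _ fun m _ => ?_
  rw [MvPolynomial.aeval_monomial, ← Algebra.smul_def, Finsupp.prod_fintype _ _ (by simp)]
  exact Submodule.smul_mem _ _ (key _)

/-- powers `p^j` of a derivation are derivations -/
theorem aux_pow_der (p : ℕ) (hp : p.Prime) [CharP k p] (D : Derivation k A A) (j : ℕ) :
    ∃ E : Derivation k A A, (E : A →ₗ[k] A) = (D : A →ₗ[k] A) ^ (p ^ j) := by
  have := Fact.mk hp
  have : ExpChar k p := ExpChar.prime hp
  open TensorProduct in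
  let d : Module.End k A := (D : A →ₗ[k] A)
  let T1 : Module.End k (TensorProduct k A A) := TensorProduct.map d 1
  let T2 : Module.End k (TensorProduct k A A) := TensorProduct.map 1 d
  let m : TensorProduct k A A →ₗ[k] A := LinearMap.mul' k A
  have hcomm : Commute T1 T2 := by
    show T1 * T2 = T2 * T1
    simp only [T1, T2, ← TensorProduct.map_mul, one_mul, mul_one]
  have hm : ∀ t, m ((T1 + T2) t) = d (m t) := by
    intro t
    induction t using TensorProduct.induction_on with
    | zero => simp
    | tmul a b => simp [m, T1, T2, d]; ring
    | add a b ha hb => simp only [map_add, ha, hb]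
  have hm' : ∀ n t, m (((T1 + T2) ^ n) t) = (d ^ n) (m t) := by
    intro n
    induction n with
    | zero => simp
    | succ n ih => intro t; rw [pow_succ', pow_succ', Module.End.mul_apply, hm, ih, Module.End.mul_apply]
  have hpow : (T1 + T2) ^ p ^ j = T1 ^ p ^ j + T2 ^ p ^ j := by
    rcases subsingleton_or_nontrivial (Module.End k (TensorProduct k A A)) with hs | hs
    · exact Subsingleton.elim _ _
    · have : CharP (Module.End k (TensorProduct k A A)) p := charP_of_injective_algebraMap (algebraMap k _).injective p
      exact add_pow_char_pow_of_commute _ _ hcomm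
  refine ⟨Derivation.mk' (d ^ p ^ j) ?_, ?_⟩
  · intro a b
    have := hm' (p ^ j) (a ⊗ₜ[k] b)
    rw [hpow] at this
    simp only [T1, T2, TensorProduct.map_pow, one_pow] at this
    simp [m] at this
    rw [← this]; simp only [smul_eq_mul]; ring
  · rfl
end Gen


theorem aux_alpha (p : ℕ) (hp : p.Prime) (k : Type*) [Field k] [CharP k p] [Infinite k]
    (r : ℕ) : ∃ β : Option (Fin r) → k, β none = 1 ∧
      ∀ c : Option (Fin r) → ℤ, ∑ j, (c j : k) * β j = 0 → ∀ j, (p : ℤ) ∣ c j := by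
  classical
  obtain ⟨β, hβ⟩ := aux_exists_indep p hp k (Option (Fin r))
  have h0 : β none ≠ 0 := by
    intro h
    have := hβ (fun j => if j = none then 1 else 0) (by simp [h]) none
    simp only [if_true] at this
    have h1 := Int.le_of_dvd one_pos this
    have h2 := hp.two_le
    omega
  refine ⟨fun j => β j / β none, div_self h0, fun c hc => hβ c ?_⟩
  have : ∑ j, (c j : k) * (β j / β none) = (∑ j, (c j : k) * β j) / β none := by
    rw [Finset.sum_div]; exact Finset.sum_congr rfl fun j _ => by ring
  rw [this] at hc
  exact (div_eq_zero_iff.1 hc).resolve_right h0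

theorem aux_moore (p : ℕ) (hp : p.Prime) (k : Type*) [Field k] [CharP k p]
    (r : ℕ) (β : Option (Fin r) → k)
    (hβ : ∀ c : Option (Fin r) → ℤ, ∑ j, (c j : k) * β j = 0 → ∀ j, (p : ℤ) ∣ c j) :
    ∃ N : Option (Fin r) → Fin (r + 1) → k, ∀ i l,
      ∑ j, N i j * β l ^ (p ^ (j : ℕ)) = if i = l then 1 else 0 := by
  classical
  have := Fact.mk hp
  have : ExpChar k p := ExpChar.prime hp
  let M : Matrix (Fin (r + 1)) (Option (Fin r)) k := fun j l => β l ^ (p ^ (j : ℕ))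
  have hinj : Function.Injective M.vecMulLinear := by
    rw [← LinearMap.ker_eq_bot, LinearMap.ker_eq_bot']
    intro c hc
    let P : Polynomial k := ∑ j : Fin (r + 1), Polynomial.C (c j) * Polynomial.X ^ (p ^ (j : ℕ))
    have hPe : ∀ t, P.eval t = ∑ j, c j * t ^ (p ^ (j : ℕ)) := by
      intro t; simp [P, Polynomial.eval_finsetSum]
    have hPl : ∀ l, P.eval (β l) = 0 := by
      intro l
      have : (Matrix.vecMul c M) l = 0 := congrFun hc l
      rw [hPe]
      simpa [Matrix.vecMul, dotProduct, M] using this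
    let S : (Option (Fin r) → Fin p) → k := fun e => ∑ l, ((e l : ℕ) : k) * β l
    have hS : Function.Injective S := by
      intro e e' hee
      ext j
      have := hβ (fun j => ((e j : ℕ) : ℤ) - ((e' j : ℕ) : ℤ)) (by
        have hee' : ∑ j, ((e j : ℕ) : k) * β j = ∑ j, ((e' j : ℕ) : k) * β j := hee
        push_cast
        simp only [sub_mul, Finset.sum_sub_distrib]
        exact sub_eq_zero.2 hee') j
      have h1 := (e j).isLt
      have h2 := (e' j).isLt
      have := Int.eq_zero_of_abs_lt_dvd this (by rw [abs_lt]; omega)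
      omega
    have hPS : ∀ e, P.eval (S e) = 0 := by
      intro e
      have h1 : P.eval (S e) = ∑ l, ((e l : ℕ) : k) * P.eval (β l) := by
        simp only [hPe, Finset.mul_sum]
        rw [Finset.sum_comm]
        refine Finset.sum_congr rfl fun j _ => ?_
        have h2 : S e ^ (p ^ (j : ℕ)) = ∑ l, ((e l : ℕ) : k) * β l ^ (p ^ (j : ℕ)) := by
          rw [← iterateFrobenius_def, map_sum]
          refine Finset.sum_congr rfl fun l _ => ?_
          rw [map_mul, map_natCast, iterateFrobenius_def]
        rw [h2, Finset.mul_sum]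
        exact Finset.sum_congr rfl fun l _ => by ring
      rw [h1]
      simp [hPl]
    have hP0 : P = 0 := by
      refine Polynomial.eq_zero_of_natDegree_lt_card_of_eval_eq_zero P hS hPS ?_
      have hd : P.natDegree ≤ p ^ r := by
        refine Polynomial.natDegree_sum_le_of_forall_le _ _ fun j _ => ?_
        refine (Polynomial.natDegree_C_mul_X_pow_le _ _).trans ?_
        exact Nat.pow_le_pow_right hp.pos (by omega)
      refine hd.trans_lt ?_
      simp only [Fintype.card_pi, Fintype.card_fin, Finset.prod_const, Finset.card_univ, Fintype.card_option]
      exact Nat.pow_lt_pow_right hp.one_lt (by omega)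
    ext j
    have := congrArg (fun Q => Polynomial.coeff Q (p ^ (j : ℕ))) hP0
    simp only [P, Polynomial.finsetSum_coeff, Polynomial.coeff_C_mul, Polynomial.coeff_X_pow,
      Nat.pow_right_inj hp.one_lt, Polynomial.coeff_zero] at this
    have h3 : ∀ x : Fin (r+1), ((j : ℕ) = (x : ℕ)) = (j = x) := fun x => by rw [Fin.ext_iff]
    simpa [h3] using this
  have hsurj : Function.Surjective M.vecMulLinear :=
    (LinearMap.injective_iff_surjective_of_finrank_eq_finrank (by simp)).1 hinj
  choose N hN using fun i => hsurj (Pi.single i 1)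
  refine ⟨N, fun i l => ?_⟩
  have : (Matrix.vecMul (N i) M) l = (Pi.single i 1 : Option (Fin r) → k) l := congrFun (hN i) l
  simp [Matrix.vecMul, dotProduct, M, Pi.single_apply] at this
  rw [this]
  simp only [eq_comm]

/-- polynomial functions -/
def PF {k A : Type*} [Field k] [CommRing A] [Algebra k A] (φ : k → A) : Prop :=
  ∃ P : Polynomial A, ∀ s, φ s = P.eval (algebraMap k A s)

namespace PF
variable {k A : Type*} [Field k] [CommRing A] [Algebra k A] {φ ψ : k → A}

theorem const (a : A) : PF (fun _ : k => a) := ⟨Polynomial.C a, by simp⟩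
theorem add (h : PF φ) (h' : PF ψ) : PF (fun s => φ s + ψ s) := by
  obtain ⟨P, hP⟩ := h; obtain ⟨Q, hQ⟩ := h'
  exact ⟨P + Q, by simp [hP, hQ]⟩
theorem mul (h : PF φ) (h' : PF ψ) : PF (fun s => φ s * ψ s) := by
  obtain ⟨P, hP⟩ := h; obtain ⟨Q, hQ⟩ := h'
  exact ⟨P * Q, by simp [hP, hQ]⟩
theorem smulX (h : PF φ) : PF (fun s => s • φ s) := by
  obtain ⟨P, hP⟩ := h
  exact ⟨Polynomial.X * P, by simp [hP, Algebra.smul_def]⟩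
theorem smulc (c : k) (h : PF φ) : PF (fun s => c • φ s) := by
  obtain ⟨P, hP⟩ := h
  exact ⟨Polynomial.C (algebraMap k A c) * P, by simp [hP, Algebra.smul_def]⟩
theorem sub (h : PF φ) (h' : PF ψ) : PF (fun s => φ s - ψ s) := by
  obtain ⟨P, hP⟩ := h; obtain ⟨Q, hQ⟩ := h'
  exact ⟨P - Q, by simp [hP, hQ]⟩
theorem pow (h : PF φ) (n : ℕ) : PF (fun s => φ s ^ n) := by
  obtain ⟨P, hP⟩ := h
  exact ⟨P ^ n, by simp [hP]⟩
theorem sum {τ : Type*} (S : Finset τ) {φ : τ → k → A} (h : ∀ i, PF (φ i)) : PF (fun s => ∑ i ∈ S, φ i s) := by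
  choose P hP using h
  exact ⟨∑ i ∈ S, P i, by simp [hP, Polynomial.eval_finsetSum]⟩
theorem prod {τ : Type*} (S : Finset τ) {φ : τ → k → A} (h : ∀ i, PF (φ i)) : PF (fun s => ∏ i ∈ S, φ i s) := by
  choose P hP using h
  exact ⟨∏ i ∈ S, P i, by simp [hP, Polynomial.eval_prod]⟩
theorem map {B : Type*} [CommRing B] [Algebra k B] (T : A →ₗ[k] B) (h : PF φ) : PF (fun s => T (φ s)) := by
  obtain ⟨P, hP⟩ := h
  have : ∃ Q : Polynomial B, ∀ s, T (P.eval (algebraMap k A s)) = Q.eval (algebraMap k B s) := by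
    clear hP
    induction P using Polynomial.induction_on' with
    | add p q hp hq =>
      obtain ⟨P, hP⟩ := hp; obtain ⟨Q, hQ⟩ := hq
      exact ⟨P + Q, by simp [hP, hQ]⟩
    | monomial n a =>
      refine ⟨Polynomial.monomial n (T a), fun s => ?_⟩
      rw [Polynomial.eval_monomial, Polynomial.eval_monomial, ← map_pow, ← map_pow, mul_comm, ← Algebra.smul_def,
        map_smul, Algebra.smul_def, mul_comm]
  obtain ⟨Q, hQ⟩ := this
  exact ⟨Q, fun s => by show T (φ s) = _; rw [hP, hQ]⟩
end PF

section Contact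

/-- Coordinates and dual derivations on a truncated polynomial ring in `2r+1` variables. -/
structure CD (k A : Type*) [Field k] [CommRing A] [Algebra k A] (p r : ℕ) where
  X : Option (Fin r ⊕ Fin r) → A
  d : Option (Fin r ⊕ Fin r) → Derivation k A A
  hd : ∀ i j, d i (X j) = if i = j then 1 else 0
  hX : ∀ j, X j ^ p = 0
  gen : Algebra.adjoin k (Set.range X) = ⊤

namespace CD
variable {k A : Type*} [Field k] [CommRing A] [Algebra k A] {p r : ℕ} (C : CD k A p r)

/-- first half of the coordinates -/
def x (i : Fin r) : A := C.X (some (Sum.inl i))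
/-- second half of the coordinates -/
def y (i : Fin r) : A := C.X (some (Sum.inr i))
/-- the last coordinate -/
def z : A := C.X none
/-- partial derivative -/
def dx (i : Fin r) := C.d (some (Sum.inl i))
/-- partial derivative -/
def dy (i : Fin r) := C.d (some (Sum.inr i))
/-- partial derivative -/
def dz := C.d none

theorem der_ext {F G : Derivation k A A} (hx : ∀ i, F (C.x i) = G (C.x i))
    (hy : ∀ i, F (C.y i) = G (C.y i)) (hz : F C.z = G C.z) : F = G := by
  ext a
  have ha : a ∈ Algebra.adjoin k (Set.range C.X) := by rw [C.gen]; trivial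
  refine Derivation.eqOn_adjoin ?_ ha
  rintro _ ⟨j, rfl⟩
  rcases j with _ | (i | i)
  · exact hz
  · exact hx i
  · exact hy i

@[simp] theorem dxx (i j) : C.dx i (C.x j) = if i = j then 1 else 0 := by simp [dx, x, C.hd]
@[simp] theorem dxy (i j) : C.dx i (C.y j) = 0 := by simp [dx, y, C.hd]
@[simp] theorem dxz (i) : C.dx i C.z = 0 := by simp [dx, z, C.hd]
@[simp] theorem dyx (i j) : C.dy i (C.x j) = 0 := by simp [dy, x, C.hd]
@[simp] theorem dyy (i j) : C.dy i (C.y j) = if i = j then 1 else 0 := by simp [dy, y, C.hd]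
@[simp] theorem dyz (i) : C.dy i C.z = 0 := by simp [dy, z, C.hd]
@[simp] theorem dzx (j) : C.dz (C.x j) = 0 := by simp [dz, x, C.hd]
@[simp] theorem dzy (j) : C.dz (C.y j) = 0 := by simp [dz, y, C.hd]
@[simp] theorem dzz : C.dz C.z = 1 := by simp [dz, z, C.hd]

/-- The contact map. -/
def Df (f : A) : Derivation k A A :=
  (∑ i, ((C.x i * C.dz f - C.dy i f) • C.dx i + (C.y i * C.dz f + C.dx i f) • C.dy i)) +
  (2 * f - ∑ i, (C.x i * C.dx i f + C.y i * C.dy i f)) • C.dz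

theorem Df_x (f : A) (j) : C.Df f (C.x j) = C.x j * C.dz f - C.dy j f := by
  simp [Df, aux_sum_apply]

theorem Df_y (f : A) (j) : C.Df f (C.y j) = C.y j * C.dz f + C.dx j f := by
  simp [Df, aux_sum_apply]

theorem Df_z (f : A) : C.Df f C.z = 2 * f - ∑ i, (C.x i * C.dx i f + C.y i * C.dy i f) := by
  simp [Df, aux_sum_apply]

theorem chain (F : Derivation k A A) (f : A) :
    F f = C.dz f * F C.z + ∑ i, (C.dx i f * F (C.x i) + C.dy i f * F (C.y i)) := by
  have : F = F C.z • C.dz + ∑ i, (F (C.x i) • C.dx i + F (C.y i) • C.dy i) := by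
    apply C.der_ext <;> simp [aux_sum_apply]
  conv_lhs => rw [this]
  simp only [Derivation.add_apply, Derivation.smul_apply, aux_sum_apply, smul_eq_mul]
  simp only [mul_comm]

/-- The contact form evaluated at an endomorphism. -/
def theta : (A →ₗ[k] A) →ₗ[k] A where
  toFun E := E C.z + ∑ i, (C.x i * E (C.y i) - C.y i * E (C.x i))
  map_add' E F := by
    simp only [LinearMap.add_apply, mul_add, add_sub_add_comm, Finset.sum_add_distrib]
    ring
  map_smul' c E := by
    simp only [LinearMap.smul_apply, mul_smul_comm, ← smul_sub, ← Finset.smul_sum, ← smul_add, RingHom.id_apply]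

theorem theta_apply (E : Derivation k A A) : C.theta (E : A →ₗ[k] A) =
    E C.z + ∑ i, (C.x i * E (C.y i) - C.y i * E (C.x i)) := rfl

theorem theta_Df (f : A) : C.theta (C.Df f : A →ₗ[k] A) = 2 * f := by
  rw [theta_apply]
  simp only [Df_x, Df_y, Df_z]
  rw [sub_add, sub_eq_self, sub_eq_zero]
  exact Finset.sum_congr rfl fun i _ => by ring

theorem theta_lie (f : A) (F : Derivation k A A) : C.theta (⁅C.Df f, F⁆ : Derivation k A A) =
    C.Df f (C.theta (F : A →ₗ[k] A)) - 2 * C.dz f * C.theta (F : A →ₗ[k] A) := by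
  have h2 : F 2 = 0 := by
    have := F.map_natCast 2
    exact_mod_cast this
  have e1 : F (C.Df f C.z) = 2 * (C.dz f * F C.z) + ∑ i,
      (2 * (C.dx i f * F (C.x i) + C.dy i f * F (C.y i)) - (C.x i * F (C.dx i f) + C.dx i f * F (C.x i)
        + (C.y i * F (C.dy i f) + C.dy i f * F (C.y i)))) := by
    rw [Df_z, map_sub, map_sum, Derivation.leibniz, h2, C.chain F f, Finset.sum_sub_distrib, ← Finset.mul_sum]
    simp only [map_add, Derivation.leibniz, smul_eq_mul]
    ring
  have e2 : C.Df f (C.theta (F : A →ₗ[k] A)) = C.Df f (F C.z) + ∑ i,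
      (C.x i * C.Df f (F (C.y i)) + F (C.y i) * (C.x i * C.dz f - C.dy i f)
        - (C.y i * C.Df f (F (C.x i)) + F (C.x i) * (C.y i * C.dz f + C.dx i f))) := by
    rw [theta_apply, map_add, map_sum]
    simp only [map_sub, Derivation.leibniz, smul_eq_mul, Df_x, Df_y]
  rw [e2, theta_apply, theta_apply]
  simp only [Derivation.commutator_apply]
  rw [e1]
  have e3 : ∑ i, (C.x i * (C.Df f (F (C.y i)) - F (C.Df f (C.y i))) -
      C.y i * (C.Df f (F (C.x i)) - F (C.Df f (C.x i)))) =
      ∑ i, (C.x i * C.Df f (F (C.y i)) + F (C.y i) * (C.x i * C.dz f - C.dy i f)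
        - (C.y i * C.Df f (F (C.x i)) + F (C.x i) * (C.y i * C.dz f + C.dx i f))) + ∑ i,
      (2 * (C.dx i f * F (C.x i) + C.dy i f * F (C.y i)) - (C.x i * F (C.dx i f) + C.dx i f * F (C.x i)
        + (C.y i * F (C.dy i f) + C.dy i f * F (C.y i)))) -
      2 * C.dz f * ∑ i, (C.x i * F (C.y i) - C.y i * F (C.x i)) := by
    rw [Finset.mul_sum, ← Finset.sum_add_distrib, ← Finset.sum_sub_distrib]
    refine Finset.sum_congr rfl fun i _ => ?_
    rw [Df_x, Df_y]
    simp only [map_sub, map_add, Derivation.leibniz, smul_eq_mul]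
    ring
  rw [e3]
  ring

/-- `E` preserves the contact form up to the factor `c`. -/
def Pres (E : Derivation k A A) (c : A) : Prop :=
  ∀ F : Derivation k A A, C.theta (⁅E, F⁆ : Derivation k A A) =
    E (C.theta (F : A →ₗ[k] A)) - c * C.theta (F : A →ₗ[k] A)

theorem pres_Df (f : A) : C.Pres (C.Df f) (2 * C.dz f) := C.theta_lie f

theorem pres_lie {E E' : Derivation k A A} {c c' : A} (h : C.Pres E c) (h' : C.Pres E' c') :
    C.Pres ⁅E, E'⁆ (E c' - E' c) := by
  intro F
  have e : ⁅⁅E, E'⁆, F⁆ = ⁅E, ⁅E', F⁆⁆ - ⁅E', ⁅E, F⁆⁆ := by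
    rw [lie_lie]
  have e' : ((⁅E, ⁅E', F⁆⁆ - ⁅E', ⁅E, F⁆⁆ : Derivation k A A) : A →ₗ[k] A) =
    (⁅E, ⁅E', F⁆⁆ : Derivation k A A) - (⁅E', ⁅E, F⁆⁆ : Derivation k A A) := rfl
  rw [e, e', map_sub, h ⁅E', F⁆, h' F, h' ⁅E, F⁆, h F]
  simp only [map_sub, Derivation.leibniz, smul_eq_mul, Derivation.commutator_apply]
  ring

theorem pres_eq (h2 : (2 : k) ≠ 0) {E : Derivation k A A} {c : A} (h : C.Pres E c) :
    E = C.Df ((2⁻¹ : k) • C.theta (E : A →ₗ[k] A)) := by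
  have h22 : (algebraMap k A 2⁻¹) * 2 = 1 := by
    have : (2 : A) = algebraMap k A 2 := (map_ofNat (algebraMap k A) 2).symm
    rw [this, ← map_mul, inv_mul_cancel₀ h2, map_one]
  set g := C.theta (E : A →ₗ[k] A) with hg
  have hgz : C.dz g = c := by
    have := h C.dz
    rw [theta_apply, theta_apply] at this
    simp [Derivation.commutator_apply] at this
    rw [hg, theta_apply, map_add, map_sum]
    simp only [map_sub, Derivation.leibniz, smul_eq_mul, dzx, dzy, mul_zero, add_zero]
    simp only [Finset.sum_add_distrib, Finset.sum_sub_distrib, Finset.sum_neg_distrib] at this ⊢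
    linear_combination -this
  have hgx : ∀ i, C.dx i g = 2 * E (C.y i) - c * C.y i := by
    intro i
    have := h (C.dx i)
    rw [theta_apply, theta_apply] at this
    simp [Derivation.commutator_apply, apply_ite E] at this
    rw [hg, theta_apply, map_add, map_sum]
    simp only [map_sub, Derivation.leibniz, smul_eq_mul, dxx, dxy, mul_zero, add_zero]
    simp [Finset.sum_add_distrib, Finset.sum_sub_distrib, Finset.sum_neg_distrib] at this ⊢
    linear_combination -this
  have hgy : ∀ i, C.dy i g = -2 * E (C.x i) + c * C.x i := by
    intro i
    have := h (C.dy i)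
    rw [theta_apply, theta_apply] at this
    simp [Derivation.commutator_apply, apply_ite E] at this
    rw [hg, theta_apply, map_add, map_sum]
    simp only [map_sub, Derivation.leibniz, smul_eq_mul, dyx, dyy, mul_zero, add_zero]
    simp [Finset.sum_add_distrib, Finset.sum_sub_distrib, Finset.sum_neg_distrib] at this ⊢
    linear_combination -this
  apply C.der_ext
  · intro i
    rw [Df_x, Derivation.map_smul, Derivation.map_smul, hgz, hgy, Algebra.smul_def, Algebra.smul_def]
    linear_combination -(E (C.x i)) * h22
  · intro i
    rw [Df_y, Derivation.map_smul, Derivation.map_smul, hgz, hgx, Algebra.smul_def, Algebra.smul_def]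
    linear_combination -(E (C.y i)) * h22
  · rw [Df_z]
    simp only [Derivation.map_smul, hgx, hgy]
    simp only [Algebra.smul_def]
    have e : ∑ i, (C.x i * ((algebraMap k A) 2⁻¹ * (2 * E (C.y i) - c * C.y i)) +
      C.y i * ((algebraMap k A) 2⁻¹ * (-2 * E (C.x i) + c * C.x i))) =
      (algebraMap k A 2⁻¹ * 2) * ∑ i, (C.x i * E (C.y i) - C.y i * E (C.x i)) := by
      rw [Finset.mul_sum]
      exact Finset.sum_congr rfl fun i _ => by ring
    rw [e]
    have := C.theta_apply E
    rw [← hg] at this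
    linear_combination (-E C.z) * h22 - 2 * (algebraMap k A) 2⁻¹ * this

/-- The contact bracket with `f`. -/
def Lf (f : A) : A →ₗ[k] A := (C.Df f : A →ₗ[k] A) - LinearMap.mulLeft k (2 * C.dz f)

theorem Lf_apply (f g : A) : C.Lf f g = C.Df f g - 2 * C.dz f * g := rfl

theorem Df_lie (h2 : (2 : k) ≠ 0) (f g : A) : ⁅C.Df f, C.Df g⁆ = C.Df (C.Lf f g) := by
  have := C.pres_eq h2 (C.pres_lie (C.pres_Df f) (C.pres_Df g))
  rw [this, C.theta_lie, theta_Df]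
  congr 1
  have h22 : (algebraMap k A 2⁻¹) * 2 = 1 := by
    have : (2 : A) = algebraMap k A 2 := (map_ofNat (algebraMap k A) 2).symm
    rw [this, ← map_mul, inv_mul_cancel₀ h2, map_one]
  have hf2 : C.Df f 2 = 0 := by
    have := (C.Df f).map_natCast 2
    exact_mod_cast this
  rw [Lf_apply, Derivation.leibniz, Algebra.smul_def, hf2]
  simp only [smul_eq_mul]
  linear_combination (C.Df f g - 2 * C.dz f * g) * h22

theorem Df_add (f g : A) : C.Df (f + g) = C.Df f + C.Df g := by
  apply C.der_ext
  · intro i; simp only [Df_x, map_add, Derivation.add_apply]; ring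
  · intro i; simp only [Df_y, map_add, Derivation.add_apply]; ring
  · simp only [Df_z, map_add, Derivation.add_apply, mul_add, Finset.sum_add_distrib]; ring

theorem Df_smul (c : k) (f : A) : C.Df (c • f) = c • C.Df f := by
  apply C.der_ext
  · intro i; simp only [Df_x, Derivation.map_smul, Derivation.smul_apply, mul_smul_comm, smul_sub]
  · intro i; simp only [Df_y, Derivation.map_smul, Derivation.smul_apply, mul_smul_comm, smul_add]
  · simp only [Df_z, Derivation.map_smul, Derivation.smul_apply, mul_smul_comm, smul_sub, ← smul_add, ← Finset.smul_sum]

theorem Df_inj (h2 : (2 : k) ≠ 0) : Function.Injective C.Df := by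
  intro f g h
  have h1 := C.theta_Df f
  rw [h, theta_Df] at h1
  have : (2 : k) • g = (2 : k) • f := by
    rw [Algebra.smul_def, Algebra.smul_def, map_ofNat (algebraMap k A) 2]; exact h1
  exact ((smul_right_injective A h2) this).symm

/-- The elements centralising `f` coming from the `p`-powers of `Df f`. -/
def G (f : A) (j : ℕ) : A := C.theta ((C.Df f : A →ₗ[k] A) ^ (p ^ j))

theorem Df_G (hp : p.Prime) [CharP k p] (f : A) (j : ℕ) : C.Df f (C.G f j) = 2 * C.dz f * C.G f j := by
  obtain ⟨E, hE⟩ := aux_pow_der p hp (C.Df f) j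
  have h := C.theta_lie f E
  have h0 : ⁅C.Df f, E⁆ = 0 := by
    ext a
    rw [Derivation.commutator_apply]
    have : ∀ a, E a = ((C.Df f : A →ₗ[k] A) ^ (p ^ j)) a := fun a => by rw [← hE]; rfl
    rw [this, this]
    show (((C.Df f : A →ₗ[k] A) * (C.Df f : A →ₗ[k] A) ^ (p ^ j)) a) -
      (((C.Df f : A →ₗ[k] A) ^ (p ^ j) * (C.Df f : A →ₗ[k] A)) a) = 0
    rw [← pow_succ', ← pow_succ, sub_self]
  rw [h0] at h
  have h3 : C.theta ((0 : Derivation k A A) : A →ₗ[k] A) = 0 := map_zero C.theta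
  rw [h3, hE] at h
  exact (sub_eq_zero.1 h.symm)


end CD
end Contact

section LinAlg
variable {k V : Type*} [Field k] [AddCommGroup V] [Module k V]

theorem aux_diag {ι : Type*} [Fintype ι] (B : Module.Basis ι k V) (T : Module.End k V) (W : ι → k)
    [DecidablePred fun e => W e = 0]
    (hT : ∀ e, T (B e) = W e • B e) :
    Module.finrank k (T.maxGenEigenspace 0) ≤ Fintype.card {e // W e = 0} := by
  classical
  have h1 : ∀ (a : V) e, B.repr (T a) e = W e * B.repr a e := by
    intro a e
    have : (B.coord e) ∘ₗ T = W e • B.coord e := by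
      refine B.ext fun e' => ?_
      simp only [LinearMap.comp_apply, hT, map_smul, LinearMap.smul_apply, smul_eq_mul, Module.Basis.coord_apply,
        Module.Basis.repr_self, Finsupp.single_apply]
      split_ifs with h
      · rw [h]
      · simp
    exact LinearMap.congr_fun this a
  have h2 : ∀ (n : ℕ) (a : V) e, B.repr ((T ^ n) a) e = W e ^ n * B.repr a e := by
    intro n
    induction n with
    | zero => simp
    | succ n ih => intro a e; rw [pow_succ', Module.End.mul_apply, h1, ih, pow_succ']; ring
  let φ : T.maxGenEigenspace 0 →ₗ[k] ({e // W e = 0} → k) :=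
    LinearMap.pi (fun e => B.coord e.1 ∘ₗ (T.maxGenEigenspace 0).subtype)
  have hφ : Function.Injective φ := by
    rw [← LinearMap.ker_eq_bot, LinearMap.ker_eq_bot']
    rintro ⟨a, ha⟩ h
    obtain ⟨n, hn⟩ := (Module.End.mem_maxGenEigenspace _ _ _).1 ha
    rw [zero_smul, sub_zero] at hn
    refine Subtype.ext (B.ext_elem fun e => ?_)
    by_cases he : W e = 0
    · have := congrFun h ⟨e, he⟩
      simpa [φ] using this
    · have := h2 n a e
      rw [hn] at this
      simp only [map_zero, Finsupp.coe_zero, Pi.zero_apply] at this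
      have := (mul_eq_zero.1 this.symm).resolve_left (pow_ne_zero n he)
      simpa using this
  have := LinearMap.finrank_le_finrank_of_injective hφ
  rwa [Module.finrank_fintype_fun_eq_card] at this

theorem aux_lower [Module.Finite k V] {ι : Type*} [Fintype ι] (T : Module.End k V) (v : ι → V)
    (hv : LinearIndependent k v) (hT : ∀ i, T (v i) = 0) :
    Fintype.card ι ≤ Module.finrank k (T.maxGenEigenspace 0) := by
  rw [← finrank_span_eq_card hv]
  refine Submodule.finrank_mono ?_
  rw [Submodule.span_le]
  rintro _ ⟨i, rfl⟩
  refine (Module.End.mem_maxGenEigenspace _ _ _).2 ⟨1, ?_⟩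
  rw [zero_smul, sub_zero, pow_one, hT]

end LinAlg

section Contact2
namespace CD
variable {k A : Type*} [Field k] [CommRing A] [Algebra k A] {p r : ℕ} (C : CD k A p r)

/-- shifted coordinates -/
def h (j : Option (Fin r ⊕ Fin r)) : A := if j = none then 1 + C.z else C.X j

@[simp] theorem h_none : C.h none = 1 + C.z := by simp [h]
@[simp] theorem h_inl (i) : C.h (some (Sum.inl i)) = C.x i := by simp [h, x]
@[simp] theorem h_inr (i) : C.h (some (Sum.inr i)) = C.y i := by simp [h, y]

theorem d_h (i j) : C.d i (C.h j) = if i = j then 1 else 0 := by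
  unfold h
  split_ifs with h1 h2 h2
  · subst h1; subst h2; simp [z, C.hd]
  · subst h1; simp [z, C.hd, h2]
  · subst h2; simp [C.hd]
  · simp [C.hd, h2]

theorem h_pow (hp : p.Prime) [CharP k p] [Nontrivial A] (j) : C.h j ^ p =
    algebraMap k A (if j = none then 1 else 0) := by
  have : CharP A p := charP_of_injective_algebraMap (algebraMap k A).injective p
  have := Fact.mk hp
  unfold h
  split_ifs with h1
  · rw [add_pow_char, one_pow, z, C.hX]; simp
  · rw [C.hX]; simp

theorem h_gen : Algebra.adjoin k (Set.range C.h) = ⊤ := by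
  rw [eq_top_iff, ← C.gen]
  refine Algebra.adjoin_le ?_
  rintro _ ⟨j, rfl⟩
  have hj : C.h j ∈ Algebra.adjoin k (Set.range C.h) := Algebra.subset_adjoin ⟨j, rfl⟩
  by_cases h1 : j = none
  · subst h1
    have := sub_mem hj (one_mem (Algebra.adjoin k (Set.range C.h)))
    simpa [z] using this
  · simpa [h, h1] using hj

/-- monomial basis -/
noncomputable def B (hp : p.Prime) [CharP k p] [Infinite k] [Nontrivial A] :
    Module.Basis (Option (Fin r ⊕ Fin r) → Fin p) k A :=
  Module.Basis.mk (aux_linind p hp C.d C.h C.d_h) (aux_span p hp C.h _ (C.h_pow hp) C.h_gen)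

theorem B_apply (hp : p.Prime) [CharP k p] [Infinite k] [Nontrivial A] (e) :
    C.B hp e = ∏ j, C.h j ^ (e j : ℕ) := by simp [B]

/-- the generic element -/
def f0 (β : Option (Fin r) → k) : A := (1 + C.z) + ∑ i, β (some i) • (C.x i * C.y i)

/-- weights -/
def wt (β : Option (Fin r) → k) : Option (Fin r ⊕ Fin r) → k
  | none => 2
  | some (Sum.inl i) => 1 - β (some i)
  | some (Sum.inr i) => 1 + β (some i)

theorem dz_f0 (β : Option (Fin r) → k) : C.dz (C.f0 β) = 1 := by
  simp [f0, map_add, map_sum, Derivation.leibniz]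

theorem dx_f0 (β : Option (Fin r) → k) (i) : C.dx i (C.f0 β) = β (some i) • C.y i := by
  simp [f0, map_add, map_sum, Derivation.leibniz]

theorem dy_f0 (β : Option (Fin r) → k) (i) : C.dy i (C.f0 β) = β (some i) • C.x i := by
  simp [f0, map_add, map_sum, Derivation.leibniz]

theorem Df_f0_h (β : Option (Fin r) → k) (j) :
    C.Df (C.f0 β) (C.h j) = algebraMap k A (wt β j) * C.h j := by
  rcases j with _ | (i | i)
  · rw [h_none, map_add, Derivation.map_one_eq_zero, zero_add, Df_z]
    simp only [dx_f0, dy_f0, wt, map_ofNat]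
    rw [f0, mul_add, add_sub_assoc, Finset.mul_sum, ← Finset.sum_sub_distrib, add_eq_left]
    refine Finset.sum_eq_zero fun i _ => ?_
    simp only [Algebra.smul_def]
    ring
  · rw [h_inl, Df_x, dz_f0, dy_f0]
    simp only [wt, Algebra.smul_def, map_sub, map_one]
    ring
  · rw [h_inr, Df_y, dz_f0, dx_f0]
    simp only [wt, Algebra.smul_def, map_add, map_one]
    ring

theorem Lf_f0_B (hp : p.Prime) [CharP k p] [Infinite k] [Nontrivial A] (β : Option (Fin r) → k) (e) :
    C.Lf (C.f0 β) (C.B hp e) = (∑ j, ((e j : ℕ) : k) * wt β j - 2) • C.B hp e := by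
  rw [Lf_apply, B_apply, aux_der_prod _ _ _ (C.Df_f0_h β), dz_f0, Algebra.smul_def]
  simp only [map_sub, map_sum, map_mul, map_natCast, map_ofNat]
  ring

theorem upper (hp : p.Prime) (h2 : (2 : k) ≠ 0) [CharP k p] [Infinite k] [Nontrivial A] (β : Option (Fin r) → k)
    (hβ1 : β none = 1)
    (hβ : ∀ c : Option (Fin r) → ℤ, ∑ j, (c j : k) * β j = 0 → ∀ j, (p : ℤ) ∣ c j) :
    Module.finrank k (Module.End.maxGenEigenspace (C.Lf (C.f0 β)) 0) ≤ p ^ r := by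
  classical
  refine (aux_diag (C.B hp) _ _ (C.Lf_f0_B hp β)).trans ?_
  have key : ∀ e : Option (Fin r ⊕ Fin r) → Fin p, ∑ j, ((e j : ℕ) : k) * wt β j - 2 = 0 →
      (∀ i, e (some (Sum.inr i)) = e (some (Sum.inl i))) ∧
      (2 * (e none : ℕ) + ∑ i, ((e (some (Sum.inl i)) : ℕ) + (e (some (Sum.inr i)) : ℕ) : k) - 2 = 0) := by
    intro e he
    let c : Option (Fin r) → ℤ := fun j => match j with
      | none => 2 * ((e none : ℕ) : ℤ) + ∑ i, (((e (some (Sum.inl i)) : ℕ) : ℤ) + ((e (some (Sum.inr i)) : ℕ) : ℤ)) - 2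
      | some i => ((e (some (Sum.inr i)) : ℕ) : ℤ) - ((e (some (Sum.inl i)) : ℕ) : ℤ)
    have hc := hβ c (by
      rw [← he]
      simp only [Fintype.sum_option, Fintype.sum_sum_type, c, hβ1, wt]
      push_cast
      simp only [mul_sub, mul_add, sub_mul, Finset.sum_add_distrib, Finset.sum_sub_distrib, mul_one]
      ring)
    constructor
    · intro i
      have h1 := hc (some i)
      have h3 := (e (some (Sum.inl i))).isLt
      have h4 := (e (some (Sum.inr i))).isLt
      have := Int.eq_zero_of_abs_lt_dvd h1 (by simp only [c]; rw [abs_lt]; omega)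
      simp only [c] at this
      ext
      omega
    · have h1 := (CharP.intCast_eq_zero_iff k p _).2 (hc none)
      simp only [c] at h1
      push_cast at h1
      exact h1
  have hinj : Function.Injective (fun (e : {e : Option (Fin r ⊕ Fin r) → Fin p //
      ∑ j, ((e j : ℕ) : k) * wt β j - 2 = 0}) (i : Fin r) => e.1 (some (Sum.inl i))) := by
    rintro ⟨e, he⟩ ⟨e', he'⟩ hee
    have hl : ∀ i, e (some (Sum.inl i)) = e' (some (Sum.inl i)) := fun i => congrFun hee i
    obtain ⟨a1, a2⟩ := key e he
    obtain ⟨b1, b2⟩ := key e' he'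
    refine Subtype.ext (funext fun j => ?_)
    show e j = e' j
    rcases j with _ | (i | i)
    · simp only [a1, b1, hl] at a2 b2
      have : (2 : k) * (((e none : ℕ) : k) - ((e' none : ℕ) : k)) = 0 := by linear_combination a2 - b2
      have := (mul_eq_zero.1 this).resolve_left h2
      have h5 : (((((e none : ℕ) : ℤ) - ((e' none : ℕ) : ℤ) : ℤ)) : k) = 0 := by push_cast; exact this
      have h1 := (CharP.intCast_eq_zero_iff k p _).1 h5
      have h3 := (e none).isLt
      have h4 := (e' none).isLt
      have := Int.eq_zero_of_abs_lt_dvd h1 (by rw [abs_lt]; omega)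
      ext
      omega
    · exact hl i
    · rw [a1, b1, hl]
  have := Fintype.card_le_of_injective _ hinj
  simpa using this

end CD
end Contact2


section Contact3
namespace CD
variable {k A : Type*} [Field k] [CommRing A] [Algebra k A] {p r : ℕ} (C : CD k A p r)

/-- the torus elements -/
def q : Option (Fin r) → A
  | none => 1 + C.z
  | some i => C.x i * C.y i

theorem pow_f0_h (β : Option (Fin r) → k) (j) (n : ℕ) :
    ((C.Df (C.f0 β) : A →ₗ[k] A) ^ n) (C.h j) = (wt β j ^ n) • C.h j := by
  induction n with
  | zero => simp
  | succ n ih =>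
    rw [pow_succ', Module.End.mul_apply, ih, map_smul]
    show _ • C.Df (C.f0 β) (C.h j) = _
    rw [Df_f0_h, ← Algebra.smul_def, smul_smul, pow_succ]

theorem G_f0 (hp : p.Prime) [CharP k p] (β : Option (Fin r) → k) (hβ1 : β none = 1) (j : ℕ) :
    C.G (C.f0 β) j = (2 : k) • ∑ l, (β l ^ (p ^ j)) • C.q l := by
  have := Fact.mk hp
  have : ExpChar k p := ExpChar.prime hp
  have hz : ((C.Df (C.f0 β) : A →ₗ[k] A) ^ (p ^ j)) C.z = (2 : k) • (1 + C.z) := by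
    have h1 := C.pow_f0_h β none (p ^ j)
    rw [h_none, map_add] at h1
    obtain ⟨m, hm⟩ := Nat.exists_eq_succ_of_ne_zero (pow_pos hp.pos j).ne'
    have h0 : ((C.Df (C.f0 β) : A →ₗ[k] A) ^ (p ^ j)) 1 = 0 := by
      rw [hm, pow_succ, Module.End.mul_apply]
      show (_ : A →ₗ[k] A) (C.Df (C.f0 β) 1) = 0
      rw [Derivation.map_one_eq_zero, map_zero]
    rw [h0, zero_add] at h1
    rw [h1]
    congr 1
    show (2 : k) ^ p ^ j = 2
    rw [← iterateFrobenius_def, map_ofNat]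
  have hx : ∀ i, ((C.Df (C.f0 β) : A →ₗ[k] A) ^ (p ^ j)) (C.x i) = (1 - β (some i) ^ (p ^ j)) • C.x i := by
    intro i
    have h1 := C.pow_f0_h β (some (Sum.inl i)) (p ^ j)
    rw [h_inl] at h1
    rw [h1]
    congr 1
    show (1 - β (some i)) ^ p ^ j = _
    rw [← iterateFrobenius_def, map_sub, map_one, iterateFrobenius_def]
  have hy : ∀ i, ((C.Df (C.f0 β) : A →ₗ[k] A) ^ (p ^ j)) (C.y i) = (1 + β (some i) ^ (p ^ j)) • C.y i := by
    intro i
    have h1 := C.pow_f0_h β (some (Sum.inr i)) (p ^ j)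
    rw [h_inr] at h1
    rw [h1]
    congr 1
    show (1 + β (some i)) ^ p ^ j = _
    rw [← iterateFrobenius_def, map_add, map_one, iterateFrobenius_def]
  show ((C.Df (C.f0 β) : A →ₗ[k] A) ^ (p ^ j)) C.z + ∑ i, (C.x i * ((C.Df (C.f0 β) : A →ₗ[k] A) ^ (p ^ j)) (C.y i)
    - C.y i * ((C.Df (C.f0 β) : A →ₗ[k] A) ^ (p ^ j)) (C.x i)) = _
  simp only [hz, hx, hy, Fintype.sum_option, q, hβ1, one_pow, one_smul, smul_add, Finset.smul_sum]
  congr 1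
  refine Finset.sum_congr rfl fun i _ => ?_
  simp only [Algebra.smul_def, map_add, map_sub, map_one, map_ofNat]
  ring

/-- combination of the `G`s -/
noncomputable def Hf (N : Option (Fin r) → Fin (r + 1) → k) (f : A) (l : Option (Fin r)) : A :=
  (2⁻¹ : k) • ∑ j : Fin (r + 1), N l j • C.G f j

theorem Hf_f0 (hp : p.Prime) (h2 : (2 : k) ≠ 0) [CharP k p] (β : Option (Fin r) → k) (hβ1 : β none = 1)
    (N : Option (Fin r) → Fin (r + 1) → k)
    (hN : ∀ i l, ∑ j, N i j * β l ^ (p ^ (j : ℕ)) = if i = l then 1 else 0) (l) :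
    C.Hf N (C.f0 β) l = C.q l := by
  unfold Hf
  simp only [C.G_f0 hp β hβ1, smul_comm _ (2 : k), ← Finset.smul_sum]
  rw [smul_smul, mul_inv_cancel₀ h2, one_smul]
  simp only [Finset.smul_sum, smul_smul]
  rw [Finset.sum_comm]
  simp only [← Finset.sum_smul, hN]
  simp

theorem Df_Hf (hp : p.Prime) [CharP k p] (N : Option (Fin r) → Fin (r + 1) → k) (f : A) (l) :
    C.Df f (C.Hf N f l) = 2 * C.dz f * C.Hf N f l := by
  unfold Hf
  simp only [Derivation.map_smul, map_sum, C.Df_G hp, mul_smul_comm, Finset.mul_sum]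

/-- exponents -/
def ee (m : Fin r → Fin p) : Option (Fin r) → ℕ
  | none => ((1 - ∑ i, ((m i : ℕ) : ZMod p) : ZMod p)).val
  | some i => m i

/-- centralising monomials -/
noncomputable def Ff (N : Option (Fin r) → Fin (r + 1) → k) (f : A) (m : Fin r → Fin p) : A :=
  ∏ l, C.Hf N f l ^ ee m l

theorem Lf_Ff (hp : p.Prime) [CharP k p] [Nontrivial A] (N : Option (Fin r) → Fin (r + 1) → k) (f : A)
    (m : Fin r → Fin p) : C.Lf f (C.Ff N f m) = 0 := by
  have := Fact.mk hp
  have hA : CharP A p := charP_of_injective_algebraMap (algebraMap k A).injective p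
  rw [Lf_apply, Ff, aux_der_prod _ _ _ (C.Df_Hf hp N f), ← Finset.sum_mul]
  have h1 : ∑ l, ((ee m l : ℕ) : A) = 1 := by
    have : (∑ l, ((ee m l : ℕ) : ZMod p)) = 1 := by
      simp [Fintype.sum_option, ee]
    have h3 := congrArg (ZMod.castHom dvd_rfl A) this
    simpa only [map_sum, map_natCast, map_one] using h3
  rw [h1, one_mul, sub_self]

/-- exponents in the basis -/
def eB (hp : p.Prime) (m : Fin r → Fin p) : Option (Fin r ⊕ Fin r) → Fin p
  | none => ⟨ee m none, by have := Fact.mk hp; exact ZMod.val_lt _⟩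
  | some (Sum.inl i) => m i
  | some (Sum.inr i) => m i

theorem eB_inj (hp : p.Prime) : Function.Injective (eB (r := r) hp) := by
  intro m m' hm
  funext i
  exact congrFun hm (some (Sum.inl i))

theorem Ff_f0 (hp : p.Prime) (h2 : (2 : k) ≠ 0) [CharP k p] [Infinite k] [Nontrivial A]
    (β : Option (Fin r) → k) (hβ1 : β none = 1)
    (N : Option (Fin r) → Fin (r + 1) → k)
    (hN : ∀ i l, ∑ j, N i j * β l ^ (p ^ (j : ℕ)) = if i = l then 1 else 0) (m) :
    C.Ff N (C.f0 β) m = C.B hp (eB hp m) := by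
  rw [Ff, B_apply]
  simp only [C.Hf_f0 hp h2 β hβ1 N hN]
  simp only [Fintype.prod_option, Fintype.prod_sum_type, h_none, h_inl, h_inr, eB, ee, q, mul_pow, Finset.prod_mul_distrib]

theorem PF_pow (f f' a : A) (n : ℕ) :
    PF (fun s : k => ((C.Df (f + s • f') : A →ₗ[k] A) ^ n) a) := by
  induction n with
  | zero => exact PF.const a
  | succ n ih =>
    have h1 := (ih.map (C.Df f : A →ₗ[k] A)).add ((ih.map (C.Df f' : A →ₗ[k] A)).smulX)
    convert h1 using 2 with s
    rw [pow_succ', Module.End.mul_apply]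
    generalize ((C.Df (f + s • f') : A →ₗ[k] A) ^ n) a = b
    rw [Df_add, Df_smul]
    rfl

theorem PF_Ff (N : Option (Fin r) → Fin (r + 1) → k) (f f' : A) (m : Fin r → Fin p) :
    PF (fun s : k => C.Ff N (f + s • f') m) := by
  refine PF.prod _ fun l => PF.pow ?_ _
  refine PF.smulc _ (PF.sum _ fun j => PF.smulc _ ?_)
  refine (C.PF_pow f f' C.z _).add (PF.sum _ fun i => ?_)
  exact ((PF.const _).mul (C.PF_pow f f' _ _)).sub ((PF.const _).mul (C.PF_pow f f' _ _))

theorem lower (hp : p.Prime) (h2 : (2 : k) ≠ 0) [CharP k p] [Infinite k] [Nontrivial A]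
    (β : Option (Fin r) → k) (hβ1 : β none = 1)
    (hβ : ∀ c : Option (Fin r) → ℤ, ∑ j, (c j : k) * β j = 0 → ∀ j, (p : ℤ) ∣ c j) (f : A) :
    ∃ Q : Polynomial k, Q ≠ 0 ∧ ∀ s : k, Q.eval s ≠ 0 →
      p ^ r ≤ Module.finrank k (Module.End.maxGenEigenspace (C.Lf (C.f0 β + s • f)) 0) := by
  classical
  obtain ⟨N, hN⟩ := aux_moore p hp k r β hβ
  have hfin : Module.Finite k A := Module.Finite.of_basis (C.B hp)
  have hq : ∀ m m', PF (fun s : k => (C.B hp).coord (eB hp m') (C.Ff N (C.f0 β + s • f) m)) :=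
    fun m m' => (C.PF_Ff N (C.f0 β) f m).map _
  choose Pm hPm using hq
  let M : Matrix (Fin r → Fin p) (Fin r → Fin p) (Polynomial k) := fun m m' => Pm m m'
  let R : k → Matrix (Fin r → Fin p) (Fin r → Fin p) k := fun s => Matrix.of fun m m' =>
      (C.B hp).coord (eB hp m') (C.Ff N (C.f0 β + s • f) m)
  have hR : ∀ s m m', R s m m' = (C.B hp).coord (eB hp m') (C.Ff N (C.f0 β + s • f) m) := fun _ _ _ => rfl
  have hM : ∀ s, M.det.eval s = (R s).det := by
    intro s
    rw [← Polynomial.coe_evalRingHom, RingHom.map_det]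
    congr 1
    ext m m'
    have := hPm m m' s
    simp only [Algebra.algebraMap_self, RingHom.id_apply] at this
    rw [hR, this]
    rfl
  refine ⟨M.det, ?_, ?_⟩
  · intro h0
    have h1 := hM 0
    rw [h0, Polynomial.eval_zero] at h1
    have h3 : R 0 = 1 := by
      ext m m'
      rw [hR, zero_smul, add_zero, C.Ff_f0 hp h2 β hβ1 N hN, Module.Basis.coord_apply, Module.Basis.repr_self,
        Finsupp.single_apply, Matrix.one_apply]
      simp only [(eB_inj hp).eq_iff]
    rw [h3, Matrix.det_one] at h1
    exact zero_ne_one h1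
  · intro s hs
    rw [hM] at hs
    have hli : LinearIndependent k (fun m => C.Ff N (C.f0 β + s • f) m) := by
      rw [Fintype.linearIndependent_iff]
      intro g hg
      have : g = 0 := by
        refine Matrix.eq_zero_of_vecMul_eq_zero hs ?_
        funext m'
        have := congrArg ((C.B hp).coord (eB hp m')) hg
        simp only [map_sum, map_smul, smul_eq_mul, map_zero] at this
        simpa only [Matrix.vecMul, dotProduct, hR, Pi.zero_apply] using this
      intro i; rw [this]; rfl
    have := aux_lower (C.Lf (C.f0 β + s • f)) _ hli (fun m => C.Lf_Ff hp N _ m)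
    simpa using this

end CD
end Contact3


theorem aux_engel {k V L : Type*} [Field k] [AddCommGroup V] [Module k V] [LieRing L] [LieAlgebra k L]
    (e : V ≃ₗ[k] L) (T : Module.End k V) (u : L) (he : ∀ g, ⁅u, e g⁆ = e (T g)) :
    Module.finrank k (LieSubalgebra.engel k u) = Module.finrank k (T.maxGenEigenspace 0) := by
  have hpow : ∀ (n : ℕ) (g : V), ((LieAlgebra.ad k L u) ^ n) (e g) = e ((T ^ n) g) := by
    intro n
    induction n with
    | zero => intro g; rfl
    | succ n ih =>
      intro g
      rw [pow_succ', pow_succ', Module.End.mul_apply, Module.End.mul_apply, ih, LieAlgebra.ad_apply, he]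
  have : (LieSubalgebra.engel k u).toSubmodule = (T.maxGenEigenspace 0).map (e : V →ₗ[k] L) := by
    ext v
    obtain ⟨g, rfl⟩ := e.surjective v
    rw [LieSubalgebra.mem_toSubmodule, LieSubalgebra.mem_engel_iff]
    have h1 : e g ∈ (T.maxGenEigenspace 0).map (e : V →ₗ[k] L) ↔ g ∈ T.maxGenEigenspace 0 := by
      constructor
      · rintro ⟨g', hg', h⟩
        rwa [← e.injective h]
      · intro h; exact ⟨g, h, rfl⟩
    rw [h1, Module.End.mem_maxGenEigenspace]
    simp only [hpow, zero_smul, sub_zero, map_eq_zero_iff e e.injective]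
  show Module.finrank k (LieSubalgebra.engel k u).toSubmodule = _
  rw [this]
  exact LinearEquiv.finrank_map_eq e _

section Contact4
namespace CD
variable {k A : Type*} [Field k] [CommRing A] [Algebra k A] {p r : ℕ} (C : CD k A p r)

/-- The image of the contact map. -/
def im (h2 : (2 : k) ≠ 0) : LieSubalgebra k (Derivation k A A) where
  carrier := Set.range C.Df
  zero_mem' := ⟨0, by have := C.Df_smul 0 0; rwa [zero_smul, zero_smul] at this⟩
  add_mem' := by
    rintro _ _ ⟨f, rfl⟩ ⟨g, rfl⟩
    exact ⟨f + g, C.Df_add f g⟩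
  smul_mem' := by
    rintro c _ ⟨f, rfl⟩
    exact ⟨c • f, C.Df_smul c f⟩
  lie_mem' := by
    rintro _ _ ⟨f, rfl⟩ ⟨g, rfl⟩
    exact ⟨C.Lf f g, (C.Df_lie h2 f g).symm⟩

theorem lieSpan_eq (h2 : (2 : k) ≠ 0) : LieSubalgebra.lieSpan k _ (Set.range C.Df) = C.im h2 := by
  apply le_antisymm
  · rw [LieSubalgebra.lieSpan_le]; exact subset_rfl
  · exact LieSubalgebra.subset_lieSpan

theorem rank_im (hp : p.Prime) (h2 : (2 : k) ≠ 0) [CharP k p] [Infinite k] [Nontrivial A] :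
    sInf {d : ℕ | ∃ H : LieSubalgebra k (C.im h2), H.IsCartanSubalgebra ∧ Module.finrank k H = d} = p ^ r := by
  obtain ⟨β, hβ1, hβ⟩ := aux_alpha p hp k r
  have hfin : Module.Finite k A := Module.Finite.of_basis (C.B hp)
  let e0 : A →ₗ[k] C.im h2 :=
    { toFun := fun f => ⟨C.Df f, f, rfl⟩
      map_add' := fun f g => Subtype.ext (C.Df_add f g)
      map_smul' := fun c f => Subtype.ext (C.Df_smul c f) }
  have he0 : Function.Bijective e0 := by
    constructor
    · intro f g h
      exact C.Df_inj h2 (congrArg Subtype.val h)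
    · rintro ⟨_, f, rfl⟩
      exact ⟨f, rfl⟩
  let e : A ≃ₗ[k] C.im h2 := LinearEquiv.ofBijective e0 he0
  have hfin2 : Module.Finite k (C.im h2) := Module.Finite.equiv e
  have hb : ∀ f g, ⁅e f, e g⁆ = e (C.Lf f g) := fun f g => Subtype.ext (C.Df_lie h2 f g)
  refine aux_cartan k (C.im h2) (p ^ r) (aux_rank k (C.im h2) (p ^ r) (e (C.f0 β)) ?_ ?_)
  · rw [aux_engel e _ _ (hb _)]
    exact C.upper hp h2 β hβ1 hβ
  · intro v
    obtain ⟨f, rfl⟩ := e.surjective v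
    obtain ⟨Q, hQ, h⟩ := C.lower hp h2 β hβ1 hβ f
    refine ⟨Q, hQ, fun s hs => ?_⟩
    rw [← map_smul, ← map_add, aux_engel e _ _ (hb _)]
    exact h s hs

end CD
end Contact4


section Inst
variable (p : ℕ) (k : Type*) [Field k] [CharP k p] (r : ℕ)

/-- Indexing of the variables. -/
def ctIdx : Option (Fin r ⊕ Fin r) → Fin (2 * r + 1)
  | none => Fin.last (2 * r)
  | some (Sum.inl i) => ⟨i.1, by have := i.isLt; omega⟩
  | some (Sum.inr i) => ⟨i.1 + r, by have := i.isLt; omega⟩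

theorem ctIdx_inj : Function.Injective (ctIdx r) := by
  intro a b hab
  have h1 := congrArg Fin.val hab
  rcases a with _ | (i | i) <;> rcases b with _ | (j | j) <;> simp only [ctIdx, Fin.val_last] at h1 <;>
    first
    | rfl
    | (have := i.isLt; have := j.isLt; omega)
    | (have := i.isLt; omega)
    | (have := j.isLt; omega)
    | (congr 2; ext; omega)

theorem ctIdx_surj : Function.Surjective (ctIdx r) := by
  intro a
  by_cases h1 : a.1 < r
  · exact ⟨some (Sum.inl ⟨a.1, h1⟩), rfl⟩
  · by_cases h2 : a.1 < 2 * r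
    · exact ⟨some (Sum.inr ⟨a.1 - r, by omega⟩), Fin.ext (by simp only [ctIdx]; omega)⟩
    · exact ⟨none, Fin.ext (by have := a.isLt; simp only [ctIdx, Fin.val_last]; omega)⟩

theorem truncPD_X (n : ℕ) (i j : Fin n) : truncPD p k n i (truncX p k n j) = if i = j then 1 else 0 := by
  classical
  show Ideal.Quotient.mk (truncIdeal p k n) (MvPolynomial.pderiv i (MvPolynomial.X j)) = _
  rw [MvPolynomial.pderiv_X, Pi.single_apply]
  by_cases h : i = j
  · simp [h]
  · simp [h, Ne.symm h]

theorem truncX_gen (n : ℕ) : Algebra.adjoin k (Set.range (truncX p k n)) = ⊤ := by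
  have h1 : Set.range (truncX p k n) = (Ideal.Quotient.mkₐ k (truncIdeal p k n)) '' Set.range MvPolynomial.X := by
    rw [← Set.range_comp]; rfl
  rw [h1, ← AlgHom.map_adjoin, MvPolynomial.adjoin_range_X, Algebra.map_top, AlgHom.range_eq_top]
  exact Ideal.Quotient.mkₐ_surjective k _

/-- The contact data on the truncated polynomial ring. -/
noncomputable def ctCD : CD k (TruncPoly p k (2 * r + 1)) p r where
  X j := truncX p k (2 * r + 1) (ctIdx r j)
  d j := truncPD p k (2 * r + 1) (ctIdx r j)
  hd i j := by
    rw [truncPD_X]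
    simp only [(ctIdx_inj r).eq_iff]
  hX j := by
    unfold truncX
    rw [← map_pow]
    exact Ideal.Quotient.eq_zero_iff_mem.2 (Ideal.subset_span ⟨_, rfl⟩)
  gen := by
    have h1 : Set.range (fun j => truncX p k (2 * r + 1) (ctIdx r j)) = Set.range (truncX p k (2 * r + 1)) :=
      (ctIdx_surj r).range_comp (truncX p k (2 * r + 1))
    rw [h1]
    exact truncX_gen p k _

theorem trunc_nontrivial (hp : p.Prime) (n : ℕ) : Nontrivial (TruncPoly p k n) := by
  refine Ideal.Quotient.nontrivial_iff.2 fun h => ?_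
  have h1 : truncIdeal p k n ≤ RingHom.ker (MvPolynomial.eval (0 : Fin n → k)) := by
    rw [Ideal.span_le]
    rintro _ ⟨i, rfl⟩
    show MvPolynomial.eval (0 : Fin n → k) (MvPolynomial.X i ^ p) = 0
    simp [hp.ne_zero]
  have h2 : (1 : MvPolynomial (Fin n) k) ∈ truncIdeal p k n := by rw [h]; trivial
  have h3 : MvPolynomial.eval (0 : Fin n → k) 1 = 0 := h1 h2
  simp at h3

theorem aux_sum_split {M : Type*} [AddCommMonoid M] (F : Fin (2 * r) → M) :
    ∑ i, F i = ∑ i : Fin r, (F ⟨i.1, by have := i.isLt; omega⟩ + F ⟨i.1 + r, by have := i.isLt; omega⟩) := by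
  let g : Fin r ⊕ Fin r → Fin (2 * r) := fun s => match s with
    | Sum.inl i => ⟨i.1, by have := i.isLt; omega⟩
    | Sum.inr i => ⟨i.1 + r, by have := i.isLt; omega⟩
  have hg : Function.Bijective g := by
    constructor
    · intro a b hab
      have h1 := congrArg Fin.val hab
      rcases a with (i | i) <;> rcases b with (j | j) <;> simp only [g] at h1 <;>
        first
        | (have := i.isLt; have := j.isLt; omega)
        | (congr 1; ext; omega)
    · intro a
      by_cases h1 : a.1 < r
      · exact ⟨Sum.inl ⟨a.1, h1⟩, rfl⟩
      · exact ⟨Sum.inr ⟨a.1 - r, by omega⟩, Fin.ext (by simp only [g]; omega)⟩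
  rw [← hg.sum_comp, Fintype.sum_sum_type, ← Finset.sum_add_distrib]

theorem DK_eq (f : TruncPoly p k (2 * r + 1)) : DK p k r f = (ctCD p k r).Df f := by
  unfold DK
  rw [aux_sum_split]
  rfl

end Inst


/-- Proposition 3.2(3).  Let `n = 2r + 1` with `n + 3 ≢ 0 (mod p)`, and
let `K''(n) = K(n)` be the restricted contact algebra.  Then `rk(K''(n)) = p^r`. -/
theorem lieRank_contactAmbient (p : ℕ) (hp : p.Prime) (hp3 : 3 ≤ p)
    (k : Type*) [Field k] [IsAlgClosed k] [CharP k p]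
    (r : ℕ) (hr : 1 ≤ r) (hmod : ¬ (p ∣ (2 * r + 1) + 3)) :
    lieRankOf k (contactAmbient p k r) = p ^ r := by
  have h2 : (2 : k) ≠ 0 := by
    intro h
    have h1 : ((2 : ℕ) : k) = 0 := by exact_mod_cast h
    have := Nat.le_of_dvd (by norm_num) ((CharP.cast_eq_zero_iff k p 2).1 h1)
    omega
  have hinf : Infinite k := IsAlgClosed.instInfinite
  have hnt := trunc_nontrivial p k hp (2 * r + 1)
  have h1 : contactAmbient p k r = (ctCD p k r).im h2 := by
    unfold contactAmbient
    rw [← (ctCD p k r).lieSpan_eq h2, show DK p k r = (ctCD p k r).Df from funext (DK_eq p k r)]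
  rw [h1]
  exact (ctCD p k r).rank_im hp h2
end
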